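/- Let d ≥ 4 and let k be a positive even integer. Suppose E ⊂ ℝ^d is a compact set with Hausdorff dimension dim_H(E) > (d+3)/2. Then there exists a non-empty open interval I ⊂ (0,∞) such that for every t ∈ I, the set E contains a non-degenerate k-necklace with constant gap t. -/

import Mathlib

open MeasureTheory Set
open scoped ENNReal

namespace Necklace

section L2

/-- The `L²` norm of a real function. -/
noncomputable def l2norm {Y : Type*} [MeasurableSpace Y] (ν : Measure Y) (f : Y → ℝ) : ℝ :=
  √(∫ y, f y ^ 2 ∂ν)

theorem l2norm_nonneg {Y : Type*} [MeasurableSpace Y] (ν : Measure Y) (f : Y → ℝ) :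
    0 ≤ l2norm ν f := Real.sqrt_nonneg _

theorem l2norm_sq {Y : Type*} [MeasurableSpace Y] (ν : Measure Y) (f : Y → ℝ) :
    l2norm ν f ^ 2 = ∫ y, f y ^ 2 ∂ν :=
  Real.sq_sqrt (integral_nonneg fun _ => sq_nonneg _)

theorem l2norm_const {Y : Type*} [MeasurableSpace Y] (ν : Measure Y) [IsProbabilityMeasure ν]
    (c : ℝ) : l2norm ν (fun _ => c) = |c| := by
  simp [l2norm, Real.sqrt_sq_eq_abs]

variable {Y : Type*} [TopologicalSpace Y] [CompactSpace Y] [MeasurableSpace Y]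
  [OpensMeasurableSpace Y] (ν : Measure Y) [IsFiniteMeasure ν]

theorem integrable_of_continuous {F : Type*} [NormedAddCommGroup F]
    [SecondCountableTopologyEither Y F] {f : Y → F} (hf : Continuous f) : Integrable f ν := by
  obtain ⟨C, hC⟩ := (isCompact_range hf).isBounded.exists_norm_le
  exact Integrable.of_bound hf.aestronglyMeasurable C (.of_forall fun y => hC _ ⟨y, rfl⟩)

theorem integral_mul_le_l2norm {f g : Y → ℝ} (hf : Continuous f) (hg : Continuous g) :
    ∫ y, f y * g y ∂ν ≤ l2norm ν f * l2norm ν g := by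
  have key (t : ℝ) : 0 ≤ (l2norm ν g ^ 2) * (t * t) + (2 * ∫ y, f y * g y ∂ν) * t
      + l2norm ν f ^ 2 := by
    have h : ∫ y, (f y + t * g y) ^ 2 ∂ν = (l2norm ν g ^ 2) * (t * t)
        + (2 * ∫ y, f y * g y ∂ν) * t + l2norm ν f ^ 2 := by
      have e : (fun y => (f y + t * g y) ^ 2)
          = fun y => (t * t) * g y ^ 2 + (2 * t) * (f y * g y) + f y ^ 2 := by
        funext y; ring
      rw [e, integral_add, integral_add, integral_const_mul, integral_const_mul, l2norm_sq,
        l2norm_sq]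
      · ring
      all_goals exact integrable_of_continuous ν (by fun_prop)
    exact h ▸ integral_nonneg fun y => sq_nonneg _
  have hd := discrim_le_zero key
  rw [discrim] at hd
  refine abs_le_of_sq_le_sq' ?_ (mul_nonneg (l2norm_nonneg _ _) (l2norm_nonneg _ _)) |>.2
  nlinarith

theorem abs_integral_mul_le_l2norm {f g : Y → ℝ} (hf : Continuous f) (hg : Continuous g) :
    |∫ y, f y * g y ∂ν| ≤ l2norm ν f * l2norm ν g := by
  refine abs_le.2 ⟨?_, integral_mul_le_l2norm ν hf hg⟩
  have := integral_mul_le_l2norm ν hf.neg hg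
  simp only [l2norm, neg_mul, integral_neg, neg_sq, Pi.neg_apply] at this ⊢
  linarith

theorem l2norm_add_le {f g : Y → ℝ} (hf : Continuous f) (hg : Continuous g) :
    l2norm ν (fun y => f y + g y) ≤ l2norm ν f + l2norm ν g := by
  refine abs_le_of_sq_le_sq' ?_ (add_nonneg (l2norm_nonneg _ _) (l2norm_nonneg _ _)) |>.2
  have e : (fun y => (f y + g y) ^ 2) = fun y => f y ^ 2 + 2 * (f y * g y) + g y ^ 2 := by
    funext y; ring
  rw [l2norm_sq, e, integral_add, integral_add, integral_const_mul, ← l2norm_sq, ← l2norm_sq]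
  · nlinarith [integral_mul_le_l2norm ν hf hg]
  all_goals exact integrable_of_continuous ν (by fun_prop)

theorem sq_integral_le [IsProbabilityMeasure ν] {f : Y → ℝ} (hf : Continuous f) :
    (∫ y, f y ∂ν) ^ 2 ≤ ∫ y, f y ^ 2 ∂ν := by
  have := abs_integral_mul_le_l2norm ν hf (continuous_const (y := (1 : ℝ)))
  rw [l2norm_const] at this
  simp only [mul_one, abs_one] at this
  rw [← l2norm_sq]
  exact sq_le_sq' (by linarith [(abs_le.1 this).1]) (abs_le.1 this).2

end L2

section Kernel

section

variable {X : Type*} [MeasurableSpace X] (μ : Measure X)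

/-- Composition of two integral kernels. -/
noncomputable def kcomp (R S : X → X → ℝ) (x y : X) : ℝ := ∫ z, R x z * S z y ∂μ

/-- Iterated composition of an integral kernel: `kpow μ R p` has `p + 1` factors. -/
noncomputable def kpow (R : X → X → ℝ) : ℕ → X → X → ℝ
  | 0 => R
  | p + 1 => kcomp μ R (kpow R p)

/-- The Hilbert–Schmidt norm of a kernel. -/
noncomputable def hsnorm (R : X → X → ℝ) : ℝ := l2norm (μ.prod μ) fun p => R p.1 p.2

theorem hsnorm_nonneg (R : X → X → ℝ) : 0 ≤ hsnorm μ R := l2norm_nonneg _ _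

theorem kpow_succ (R : X → X → ℝ) (p : ℕ) : kpow μ R (p + 1) = kcomp μ R (kpow μ R p) := rfl

theorem kpow_nonneg {R : X → X → ℝ} (hR : ∀ x y, 0 ≤ R x y) (p : ℕ) (x y : X) :
    0 ≤ kpow μ R p x y := by
  induction p generalizing x y with
  | zero => exact hR x y
  | succ p ih => exact integral_nonneg fun z => mul_nonneg (hR _ _) (ih _ _)

end

variable {X : Type*} [MetricSpace X] [CompactSpace X] [MeasurableSpace X] [BorelSpace X]
  (μ : Measure X) [IsFiniteMeasure μ]

theorem continuous_integral {A : Type*} [TopologicalSpace A] [FirstCountableTopology A]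
    [LocallyCompactSpace A] {F : A → X → ℝ} (hF : Continuous fun p : A × X => F p.1 p.2) :
    Continuous fun a => ∫ x, F a x ∂μ := by
  simpa using continuous_parametric_integral_of_continuous (μ := μ) (f := F) hF isCompact_univ

theorem integral_swap {F : X → X → ℝ} (hF : Continuous fun p : X × X => F p.1 p.2) :
    ∫ x, ∫ y, F x y ∂μ ∂μ = ∫ y, ∫ x, F x y ∂μ ∂μ :=
  integral_integral_swap (integrable_of_continuous (μ.prod μ) hF)

theorem integral_prod_eq {F : X → X → ℝ} (hF : Continuous fun p : X × X => F p.1 p.2) :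
    ∫ p, F p.1 p.2 ∂(μ.prod μ) = ∫ x, ∫ y, F x y ∂μ ∂μ :=
  integral_prod _ (integrable_of_continuous (μ.prod μ) hF)

theorem continuous_kcomp {R S : X → X → ℝ} (hR : Continuous fun p : X × X => R p.1 p.2)
    (hS : Continuous fun p : X × X => S p.1 p.2) :
    Continuous fun p : X × X => kcomp μ R S p.1 p.2 := by
  refine continuous_integral μ (F := fun (p : X × X) z => R p.1 z * S z p.2) ?_
  exact (hR.comp (f := fun q : (X × X) × X => (q.1.1, q.2)) (by fun_prop)).mul
    (hS.comp (f := fun q : (X × X) × X => (q.2, q.1.2)) (by fun_prop))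

theorem continuous_kpow {R : X → X → ℝ} (hR : Continuous fun p : X × X => R p.1 p.2) (p : ℕ) :
    Continuous fun q : X × X => kpow μ R p q.1 q.2 := by
  induction p with
  | zero => exact hR
  | succ p ih => exact continuous_kcomp μ hR ih

theorem kcomp_assoc {R S T : X → X → ℝ} (hR : Continuous fun p : X × X => R p.1 p.2)
    (hS : Continuous fun p : X × X => S p.1 p.2) (hT : Continuous fun p : X × X => T p.1 p.2) :
    kcomp μ (kcomp μ R S) T = kcomp μ R (kcomp μ S T) := by
  funext x y
  simp only [kcomp, ← integral_const_mul, ← integral_mul_const]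
  rw [integral_swap μ]
  · simp only [mul_assoc]
  · exact ((hR.comp (f := fun q : X × X => (x, q.2)) (by fun_prop)).mul
      (hS.comp (f := fun q : X × X => (q.2, q.1)) (by fun_prop))).mul
      (hT.comp (f := fun q : X × X => (q.1, y)) (by fun_prop))

theorem kcomp_kpow_comm {R : X → X → ℝ} (hR : Continuous fun p : X × X => R p.1 p.2) (p : ℕ) :
    kcomp μ (kpow μ R p) R = kpow μ R (p + 1) := by
  induction p with
  | zero => rfl
  | succ p ih =>
    rw [kpow, kcomp_assoc μ hR (continuous_kpow μ hR p) hR, ih]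
    rfl

theorem kpow_symm {R : X → X → ℝ} (hR : Continuous fun p : X × X => R p.1 p.2)
    (hs : ∀ x y, R x y = R y x) (p : ℕ) (x y : X) : kpow μ R p x y = kpow μ R p y x := by
  induction p generalizing x y with
  | zero => exact hs x y
  | succ p ih =>
    conv_rhs => rw [← kcomp_kpow_comm μ hR]
    simp only [kpow, kcomp]
    exact integral_congr_ae (.of_forall fun z => by simp only [hs x z, ih z y]; ring)

/-- `C` bounds the norm of the operator on `L²` with kernel `R`. -/
def OpBound (R : X → X → ℝ) (C : ℝ) : Prop :=
  ∀ f g : X → ℝ, Continuous f → Continuous g →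
    |∫ x, (∫ y, R x y * f y ∂μ) * g x ∂μ| ≤ C * l2norm μ f * l2norm μ g

theorem continuous_apply_kernel {R : X → X → ℝ} (hR : Continuous fun p : X × X => R p.1 p.2)
    {f : X → ℝ} (hf : Continuous f) : Continuous fun x => ∫ y, R x y * f y ∂μ :=
  continuous_integral μ (F := fun x y => R x y * f y) (hR.mul (hf.comp continuous_snd))

theorem OpBound.l2norm_le {R : X → X → ℝ} (hR : Continuous fun p : X × X => R p.1 p.2) {C : ℝ}
    (h : OpBound μ R C) (hC : 0 ≤ C) {f : X → ℝ} (hf : Continuous f) :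
    l2norm μ (fun x => ∫ y, R x y * f y ∂μ) ≤ C * l2norm μ f := by
  have h1 := h f _ hf (continuous_apply_kernel μ hR hf)
  simp only [← sq] at h1
  rw [← l2norm_sq, abs_of_nonneg (sq_nonneg _)] at h1
  rcases (l2norm_nonneg μ fun x => ∫ y, R x y * f y ∂μ).eq_or_lt with h0 | h0
  · rw [← h0]
    exact mul_nonneg hC (l2norm_nonneg _ _)
  · rw [sq] at h1
    exact le_of_mul_le_mul_right h1 h0

theorem hsnorm_sq {R : X → X → ℝ} (hR : Continuous fun p : X × X => R p.1 p.2) :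
    hsnorm μ R ^ 2 = ∫ x, ∫ y, R x y ^ 2 ∂μ ∂μ := by
  rw [hsnorm, l2norm_sq]
  exact integral_prod_eq μ (F := fun x y => R x y ^ 2) (hR.pow 2)

theorem hsnorm_kcomp_le {R S : X → X → ℝ} (hR : Continuous fun p : X × X => R p.1 p.2)
    (hS : Continuous fun p : X × X => S p.1 p.2) {C : ℝ} (h : OpBound μ R C) (hC : 0 ≤ C) :
    hsnorm μ (kcomp μ R S) ≤ C * hsnorm μ S := by
  refine abs_le_of_sq_le_sq' ?_ (mul_nonneg hC (hsnorm_nonneg _ _)) |>.2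
  have hc := continuous_kcomp μ hR hS
  have hS' : Continuous fun p : X × X => S p.2 p.1 := hS.comp continuous_swap
  have hc' : Continuous fun p : X × X => kcomp μ R S p.2 p.1 := hc.comp continuous_swap
  rw [mul_pow, hsnorm_sq μ hc, hsnorm_sq μ hS,
    integral_swap μ (F := fun x y => kcomp μ R S x y ^ 2) (hc.pow 2),
    integral_swap μ (F := fun x y => S x y ^ 2) (hS.pow 2), ← integral_const_mul]
  refine integral_mono (integrable_of_continuous μ (continuous_integral μ (hc'.pow 2)))
    (integrable_of_continuous μ ((continuous_integral μ (hS'.pow 2)).const_mul _)) fun y => ?_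
  have hy : Continuous fun z => S z y := hS.comp (f := fun z => (z, y)) (by fun_prop)
  have := pow_le_pow_left₀ (l2norm_nonneg _ _) (h.l2norm_le μ hR hC hy) 2
  rwa [mul_pow, l2norm_sq, l2norm_sq] at this

theorem hsnorm_swap {R : X → X → ℝ} (hR : Continuous fun p : X × X => R p.1 p.2) :
    hsnorm μ (fun x y => R y x) = hsnorm μ R := by
  refine (sq_eq_sq₀ (hsnorm_nonneg _ _) (hsnorm_nonneg _ _)).1 ?_
  rw [hsnorm_sq μ (R := fun x y => R y x) (hR.comp continuous_swap), hsnorm_sq μ hR]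
  exact integral_swap μ (F := fun x y => R y x ^ 2) ((hR.comp continuous_swap).pow 2)

theorem hsnorm_add_le {R S : X → X → ℝ} (hR : Continuous fun p : X × X => R p.1 p.2)
    (hS : Continuous fun p : X × X => S p.1 p.2) :
    hsnorm μ (fun x y => R x y + S x y) ≤ hsnorm μ R + hsnorm μ S :=
  l2norm_add_le _ hR hS

end Kernel

section Powers

variable {X : Type*} [MetricSpace X] [CompactSpace X] [MeasurableSpace X] [BorelSpace X]
  (μ : Measure X) [IsFiniteMeasure μ]

theorem kcomp_sub_left {R R' S : X → X → ℝ} (hR : Continuous fun p : X × X => R p.1 p.2)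
    (hR' : Continuous fun p : X × X => R' p.1 p.2) (hS : Continuous fun p : X × X => S p.1 p.2)
    (x y : X) :
    kcomp μ (fun x y => R x y - R' x y) S x y = kcomp μ R S x y - kcomp μ R' S x y := by
  have hR1 : Continuous fun z => R x z := hR.comp (f := fun z => (x, z)) (by fun_prop)
  have hR2 : Continuous fun z => R' x z := hR'.comp (f := fun z => (x, z)) (by fun_prop)
  have hS1 : Continuous fun z => S z y := hS.comp (f := fun z => (z, y)) (by fun_prop)
  simp only [kcomp, sub_mul]
  exact integral_sub (integrable_of_continuous μ (hR1.mul hS1))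
    (integrable_of_continuous μ (hR2.mul hS1))

theorem kcomp_sub_right {R S S' : X → X → ℝ} (hR : Continuous fun p : X × X => R p.1 p.2)
    (hS : Continuous fun p : X × X => S p.1 p.2) (hS' : Continuous fun p : X × X => S' p.1 p.2)
    (x y : X) :
    kcomp μ R (fun x y => S x y - S' x y) x y = kcomp μ R S x y - kcomp μ R S' x y := by
  have hR1 : Continuous fun z => R x z := hR.comp (f := fun z => (x, z)) (by fun_prop)
  have hS1 : Continuous fun z => S z y := hS.comp (f := fun z => (z, y)) (by fun_prop)
  have hS2 : Continuous fun z => S' z y := hS'.comp (f := fun z => (z, y)) (by fun_prop)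
  simp only [kcomp, mul_sub]
  exact integral_sub (integrable_of_continuous μ (hR1.mul hS1))
    (integrable_of_continuous μ (hR1.mul hS2))

theorem hsnorm_kcomp_le_right {R S : X → X → ℝ} (hR : Continuous fun p : X × X => R p.1 p.2)
    (hS : Continuous fun p : X × X => S p.1 p.2) (hsR : ∀ x y, R x y = R y x)
    (hsS : ∀ x y, S x y = S y x) {C : ℝ} (h : OpBound μ R C) (hC : 0 ≤ C) :
    hsnorm μ (kcomp μ S R) ≤ C * hsnorm μ S := by
  have e : kcomp μ S R = fun x y => kcomp μ R S y x := by
    funext x y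
    refine integral_congr_ae (.of_forall fun z => ?_)
    simp only [hsS x z, hsR z y, mul_comm]
  rw [e, hsnorm_swap μ (continuous_kcomp μ hR hS)]
  exact hsnorm_kcomp_le μ hR hS h hC

/-- A sequence of kernels whose increments decay geometrically in Hilbert–Schmidt norm is
Cauchy. -/
theorem hsnorm_sub_le_of_geometric {F : ℕ → X → X → ℝ}
    (hF : ∀ n, Continuous fun p : X × X => F n p.1 p.2) {B ρ : ℝ} (hB : 0 ≤ B) (hρ : 0 ≤ ρ)
    (hρ1 : ρ < 1) (h : ∀ n, hsnorm μ (fun x y => F (n + 1) x y - F n x y) ≤ B * ρ ^ n)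
    (m j : ℕ) : hsnorm μ (fun x y => F (m + j) x y - F m x y) ≤ B / (1 - ρ) * ρ ^ m := by
  suffices H : hsnorm μ (fun x y => F (m + j) x y - F m x y)
      ≤ B / (1 - ρ) * (ρ ^ m - ρ ^ (m + j)) by
    refine H.trans (mul_le_mul_of_nonneg_left ?_ (div_nonneg hB (by linarith)))
    linarith [pow_nonneg hρ (m + j)]
  induction j with
  | zero => simp [hsnorm, l2norm]
  | succ j ih =>
    have e : (fun x y => F (m + (j + 1)) x y - F m x y)
        = fun x y => (F (m + j + 1) x y - F (m + j) x y) + (F (m + j) x y - F m x y) := by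
      funext x y
      rw [← add_assoc]
      ring
    rw [e]
    refine (hsnorm_add_le μ (R := fun x y => F (m + j + 1) x y - F (m + j) x y)
      (S := fun x y => F (m + j) x y - F m x y) ((hF _).sub (hF _)) ((hF _).sub (hF _))).trans
      ((add_le_add (h _) ih).trans (le_of_eq ?_))
    have : 1 - ρ ≠ 0 := by linarith
    field_simp
    ring

/-- A sequence of continuous symmetric kernels, uniformly bounded as operators on `L²`, whose
increments decay faster in operator norm than their Hilbert–Schmidt norms grow. -/
structure KernelSeq (σ : ℕ → X → X → ℝ) (C a b : ℝ) : Prop where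
  cont : ∀ n, Continuous fun p : X × X => σ n p.1 p.2
  symm : ∀ n x y, σ n x y = σ n y x
  C_nonneg : 0 ≤ C
  a_nonneg : 0 ≤ a
  one_le_b : 1 ≤ b
  ab_lt : a * b < 1
  opBound : ∀ n, OpBound μ (σ n) C
  opBound_sub : ∀ n, OpBound μ (fun x y => σ (n + 1) x y - σ n x y) (C * a ^ n)
  hsnorm_le : ∀ n, hsnorm μ (σ n) ≤ C * b ^ n

variable {μ} {σ : ℕ → X → X → ℝ} {C a b : ℝ}

theorem KernelSeq.hsnorm_kpow_sub (h : KernelSeq μ σ C a b) (p : ℕ) :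
    ∃ B, 0 ≤ B ∧ ∀ n, hsnorm μ (fun x y => kpow μ (σ (n + 1)) (p + 1) x y
      - kpow μ (σ n) (p + 1) x y) ≤ B * (a * b) ^ n := by
  have hC := h.C_nonneg
  have ha := h.a_nonneg
  have hb := h.one_le_b
  have hCa (n : ℕ) : 0 ≤ C * a ^ n := by positivity
  have hsub (n : ℕ) : Continuous fun p : X × X => (fun x y => σ (n + 1) x y - σ n x y) p.1 p.2 :=
    (h.cont _).sub (h.cont _)
  induction p with
  | zero =>
    refine ⟨C * C * b + C * C, by positivity, fun n => ?_⟩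
    have e : (fun x y => kpow μ (σ (n + 1)) (0 + 1) x y - kpow μ (σ n) (0 + 1) x y)
        = fun x y => kcomp μ (fun x y => σ (n + 1) x y - σ n x y) (σ (n + 1)) x y
          + kcomp μ (σ n) (fun x y => σ (n + 1) x y - σ n x y) x y := by
      funext x y
      rw [kcomp_sub_left μ (h.cont _) (h.cont _) (h.cont _),
        kcomp_sub_right μ (h.cont _) (h.cont _) (h.cont _)]
      simp only [kpow]
      ring
    rw [e]
    refine (hsnorm_add_le μ (continuous_kcomp μ (hsub n) (h.cont _))
      (continuous_kcomp μ (h.cont _) (hsub n))).trans ?_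
    have h1 := hsnorm_kcomp_le μ (hsub n) (h.cont (n + 1)) (h.opBound_sub n) (hCa n)
    have h2 := hsnorm_kcomp_le_right μ (hsub n) (h.cont n)
      (fun x y => by simp only [h.symm _ x y]) (h.symm n) (h.opBound_sub n) (hCa n)
    have h3 := mul_le_mul_of_nonneg_left (h.hsnorm_le (n + 1)) (hCa n)
    have h4 := mul_le_mul_of_nonneg_left (h.hsnorm_le n) (hCa n)
    calc _ ≤ C * a ^ n * (C * b ^ (n + 1)) + C * a ^ n * (C * b ^ n) := by linarith
      _ = _ := by ring
  | succ p ih =>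
    obtain ⟨B, hB, ih⟩ := ih
    have hab : 0 ≤ a * b := by positivity
    obtain ⟨D, hD, hbd⟩ : ∃ D, 0 ≤ D ∧ ∀ n, hsnorm μ (kpow μ (σ n) (p + 1)) ≤ D := by
      refine ⟨B / (1 - a * b) + hsnorm μ (kpow μ (σ 0) (p + 1)), add_nonneg
        (div_nonneg hB (by linarith [h.ab_lt])) (hsnorm_nonneg _ _), fun n => ?_⟩
      have := hsnorm_sub_le_of_geometric μ (fun n => continuous_kpow μ (h.cont n) (p + 1)) hB hab
        h.ab_lt ih 0 n
      rw [zero_add, pow_zero, mul_one] at this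
      have e := hsnorm_add_le μ (R := fun x y => kpow μ (σ n) (p + 1) x y
        - kpow μ (σ 0) (p + 1) x y) ((continuous_kpow μ (h.cont n) _).sub
        (continuous_kpow μ (h.cont 0) _)) (continuous_kpow μ (h.cont 0) (p + 1))
      simp only [sub_add_cancel] at e
      linarith
    refine ⟨C * B + C * D, by positivity, fun n => ?_⟩
    have hK (n : ℕ) := continuous_kpow μ (h.cont n) (p + 1)
    have hKs : Continuous fun q : X × X => (fun x y => kpow μ (σ (n + 1)) (p + 1) x y
      - kpow μ (σ n) (p + 1) x y) q.1 q.2 := (hK _).sub (hK _)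
    have e : (fun x y => kpow μ (σ (n + 1)) (p + 1 + 1) x y - kpow μ (σ n) (p + 1 + 1) x y)
        = fun x y => kcomp μ (σ (n + 1)) (fun x y => kpow μ (σ (n + 1)) (p + 1) x y
          - kpow μ (σ n) (p + 1) x y) x y
          + kcomp μ (fun x y => σ (n + 1) x y - σ n x y) (kpow μ (σ n) (p + 1)) x y := by
      funext x y
      rw [kcomp_sub_left μ (h.cont _) (h.cont _) (hK _),
        kcomp_sub_right μ (h.cont _) (hK _) (hK _)]
      rw [kpow_succ μ (σ (n + 1)) (p + 1), kpow_succ μ (σ n) (p + 1)]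
      ring
    rw [e]
    refine (hsnorm_add_le μ (continuous_kcomp μ (h.cont _) hKs)
      (continuous_kcomp μ (hsub n) (hK _))).trans ?_
    have h1 := hsnorm_kcomp_le μ (S := fun x y => kpow μ (σ (n + 1)) (p + 1) x y
      - kpow μ (σ n) (p + 1) x y) (h.cont (n + 1)) hKs (h.opBound _) hC
    have h2 := hsnorm_kcomp_le μ (hsub n) (hK n) (h.opBound_sub n) (hCa n)
    have h3 := mul_le_mul_of_nonneg_left (ih n) hC
    have h4 := mul_le_mul_of_nonneg_left (hbd n) (hCa n)
    have h5 : a ^ n ≤ (a * b) ^ n :=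
      pow_le_pow_left₀ ha (le_mul_of_one_le_right ha hb) n
    have h6 := mul_le_mul_of_nonneg_left h5 (mul_nonneg hC hD)
    calc _ ≤ C * (B * (a * b) ^ n) + C * a ^ n * D := by linarith
      _ ≤ C * (B * (a * b) ^ n) + C * D * (a * b) ^ n := by linarith
      _ = _ := by ring

/-- The iterated kernels converge in Hilbert–Schmidt norm. -/
theorem KernelSeq.hsnorm_kpow_cauchy (h : KernelSeq μ σ C a b) (p : ℕ) {δ : ℝ} (hδ : 0 < δ) :
    ∃ N, ∀ n, N ≤ n → hsnorm μ (fun x y => kpow μ (σ n) (p + 1) x y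
      - kpow μ (σ N) (p + 1) x y) ≤ δ := by
  obtain ⟨B, hB, hn⟩ := h.hsnorm_kpow_sub p
  have hab : 0 ≤ a * b := mul_nonneg h.a_nonneg (zero_le_one.trans h.one_le_b)
  have ht : Filter.Tendsto (fun n : ℕ => B / (1 - a * b) * (a * b) ^ n) Filter.atTop (nhds 0) := by
    simpa using (tendsto_pow_atTop_nhds_zero_of_lt_one hab h.ab_lt).const_mul (B / (1 - a * b))
  obtain ⟨N, hN⟩ := (ht.eventually (gt_mem_nhds hδ)).exists
  refine ⟨N, fun n hNn => ?_⟩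
  obtain ⟨j, rfl⟩ := Nat.exists_eq_add_of_le hNn
  exact (hsnorm_sub_le_of_geometric μ (fun n => continuous_kpow μ (h.cont n) (p + 1)) hB hab
    h.ab_lt hn N j).trans hN.le

end Powers

section Mass

variable {X : Type*} [MetricSpace X] [CompactSpace X] [MeasurableSpace X] [BorelSpace X]
  (μ : Measure X) [IsProbabilityMeasure μ] {R : X → X → ℝ}

theorem integral_kpow_succ (hR : Continuous fun p : X × X => R p.1 p.2) (p : ℕ) (x : X) :
    ∫ y, kpow μ R (p + 1) x y ∂μ = ∫ z, R x z * ∫ y, kpow μ R p z y ∂μ ∂μ := by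
  have hx : Continuous fun z => R x z := hR.comp (f := fun z => (x, z)) (by fun_prop)
  simp only [kpow, kcomp, ← integral_const_mul]
  exact integral_swap μ (F := fun y z => R x z * kpow μ R p z y)
    ((hx.comp continuous_snd).mul ((continuous_kpow μ hR p).comp continuous_swap))

theorem continuous_integral_kpow (hR : Continuous fun p : X × X => R p.1 p.2) (p : ℕ) :
    Continuous fun x => ∫ y, kpow μ R p x y ∂μ :=
  continuous_integral μ (continuous_kpow μ hR p)

theorem l2norm_integral_kpow_le (hR : Continuous fun p : X × X => R p.1 p.2) {C : ℝ}
    (hC : 0 ≤ C) (h : OpBound μ R C) (p : ℕ) :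
    l2norm μ (fun x => ∫ y, kpow μ R p x y ∂μ) ≤ C ^ (p + 1) := by
  induction p with
  | zero =>
    have := h.l2norm_le μ hR hC (continuous_const (y := (1 : ℝ)))
    rw [l2norm_const] at this
    simpa [kpow] using this
  | succ p ih =>
    simp only [integral_kpow_succ μ hR]
    refine (h.l2norm_le μ hR hC (continuous_integral_kpow μ hR p)).trans ?_
    rw [pow_succ' C]
    exact mul_le_mul_of_nonneg_left ih hC

theorem integral_kpow_le (hR : Continuous fun p : X × X => R p.1 p.2) {C : ℝ}
    (hC : 0 ≤ C) (h : OpBound μ R C) (p : ℕ) :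
    ∫ x, ∫ y, kpow μ R p x y ∂μ ∂μ ≤ C ^ (p + 1) := by
  refine le_trans ?_ (l2norm_integral_kpow_le μ hR hC h p)
  exact (abs_le_of_sq_le_sq' ((sq_integral_le μ (continuous_integral_kpow μ hR p)).trans_eq
    (l2norm_sq μ _).symm) (l2norm_nonneg _ _)).2

/-- Powers of a symmetric kernel have total mass at least the power of the total mass. -/
theorem pow_le_l2norm_integral_kpow (hR : Continuous fun p : X × X => R p.1 p.2)
    (hs : ∀ x y, R x y = R y x) {c : ℝ} (hc : 0 < c) (h : c ≤ ∫ x, ∫ y, R x y ∂μ ∂μ) (p : ℕ) :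
    c ^ (p + 1) ≤ l2norm μ (fun x => ∫ y, kpow μ R p x y ∂μ) := by
  set f : ℕ → X → ℝ := fun p x => ∫ y, kpow μ R p x y ∂μ with hf
  have hfc (p : ℕ) : Continuous (f p) := continuous_integral_kpow μ hR p
  have h0 : c ≤ l2norm μ (f 0) :=
    h.trans (abs_le_of_sq_le_sq' ((sq_integral_le μ (hfc 0)).trans_eq (l2norm_sq μ _).symm)
      (l2norm_nonneg _ _)).2
  have hmove (u v : X → ℝ) (hu : Continuous u) (hv : Continuous v) :
      ∫ x, (∫ y, R x y * u y ∂μ) * v x ∂μ = ∫ x, u x * ∫ y, R x y * v y ∂μ ∂μ := by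
    simp only [← integral_const_mul, ← integral_mul_const]
    rw [integral_swap μ ((hR.mul (hu.comp continuous_snd)).mul (hv.comp continuous_fst))]
    refine integral_congr_ae (.of_forall fun x => integral_congr_ae (.of_forall fun y => ?_))
    simp only [hs y x]
    ring
  have hstep : ∀ p, l2norm μ (f p) * c ≤ l2norm μ (f (p + 1)) := by
    intro p
    induction p with
    | zero =>
      have e : l2norm μ (f 0) ^ 2 = ∫ x, 1 * f 1 x ∂μ := by
        rw [l2norm_sq]
        have := hmove (fun _ => 1) (f 0) continuous_const (hfc 0)
        simp only [mul_one, one_mul] at this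
        simp only [hf, one_mul, integral_kpow_succ μ hR 0, sq]
        exact this
      have := integral_mul_le_l2norm μ (continuous_const (y := (1 : ℝ))) (hfc 1)
      rw [← e, l2norm_const, abs_one, one_mul] at this
      nlinarith [l2norm_nonneg μ (f 0)]
    | succ p ih =>
      have e : l2norm μ (f (p + 1)) ^ 2 = ∫ x, f p x * f (p + 2) x ∂μ := by
        rw [l2norm_sq]
        have := hmove (f p) (f (p + 1)) (hfc _) (hfc _)
        simp only [hf, integral_kpow_succ μ hR (p + 1), integral_kpow_succ μ hR p] at this ⊢
        rw [← this]
        simp only [sq]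
      have h1 := integral_mul_le_l2norm μ (hfc p) (hfc (p + 2))
      rw [← e] at h1
      rcases (l2norm_nonneg μ (f p)).eq_or_lt with h2 | h2
      · rw [← h2, zero_mul] at h1
        have : l2norm μ (f (p + 1)) = 0 := by nlinarith
        rw [this, zero_mul]
        exact l2norm_nonneg _ _
      · refine le_of_mul_le_mul_left ?_ h2
        nlinarith [l2norm_nonneg μ (f (p + 1))]
  induction p with
  | zero => simpa using h0
  | succ p ih =>
    rw [pow_succ]
    exact (mul_le_mul_of_nonneg_right ih hc.le).trans (hstep p)

theorem l2norm_integral_le_hsnorm {H : X → X → ℝ} (hH : Continuous fun p : X × X => H p.1 p.2) :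
    l2norm μ (fun x => ∫ y, H x y ∂μ) ≤ hsnorm μ H := by
  refine abs_le_of_sq_le_sq' ?_ (hsnorm_nonneg _ _) |>.2
  rw [l2norm_sq, hsnorm_sq μ hH]
  refine integral_mono (integrable_of_continuous μ ((continuous_integral μ hH).pow 2))
    (integrable_of_continuous μ (continuous_integral μ (hH.pow 2))) fun x => ?_
  exact sq_integral_le μ (hH.comp (f := fun y => (x, y)) (by fun_prop))

end Mass

section Walk

/-- The weight of the walk `y, u 0, …, u (l - 1), w`. -/
noncomputable def walk {X : Type*} (R : X → X → ℝ) : (l : ℕ) → X → (Fin l → X) → X → ℝ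
  | 0, y, _, w => R y w
  | l + 1, y, u, w => R y (u 0) * walk R l (u 0) (Fin.tail u) w

theorem walk_nonneg {X : Type*} {R : X → X → ℝ} (hR : ∀ x y, 0 ≤ R x y) (l : ℕ) (y : X)
    (u : Fin l → X) (w : X) : 0 ≤ walk R l y u w := by
  induction l generalizing y with
  | zero => exact hR _ _
  | succ l ih => exact mul_nonneg (hR _ _) (ih _ _)

theorem walk_eq_prod {X : Type*} (R : X → X → ℝ) (l : ℕ) (y : X) (u : Fin l → X) (w : X) :
    walk R l y u w = ∏ i : Fin (l + 1),
      R (Fin.cons (α := fun _ => X) y u i) (Fin.snoc (α := fun _ => X) u w i) := by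
  induction l generalizing y with
  | zero => simp [walk, Fin.snoc]
  | succ l ih =>
    rw [walk, ih, Fin.prod_univ_succ (n := l + 1)]
    refine congrArg₂ (· * ·) ?_ (Finset.prod_congr rfl fun i _ => ?_)
    · rw [Fin.cons_zero]
      rfl
    rw [Fin.cons_succ]
    congr 1
    · exact (congrFun (Fin.cons_self_tail u) i)
    · conv_rhs => rw [← Fin.cons_self_tail u]
      exact congrFun (Fin.cons_snoc_eq_snoc_cons (β := X) (u 0) (Fin.tail u) w) i.succ

/-- The weight of the closed walk `x 0, …, x l, x 0`. -/
noncomputable def cycle {X : Type*} (R : X → X → ℝ) (l : ℕ) (x : Fin (l + 1) → X) : ℝ :=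
  walk R l (x 0) (Fin.tail x) (x 0)

theorem cycle_eq_prod {X : Type*} (R : X → X → ℝ) (l : ℕ) (x : Fin (l + 1) → X) :
    cycle R l x = ∏ i, R (x i) (x (i + 1)) := by
  rw [cycle, walk_eq_prod]
  refine Finset.prod_congr rfl fun i _ => ?_
  congr 1
  · exact congrFun (Fin.cons_self_tail x) i
  · induction i using Fin.lastCases with
    | last => simp
    | cast i => rw [Fin.snoc_castSucc, Fin.coeSucc_eq_succ]; rfl

theorem cycle_rotate {X : Type*} (R : X → X → ℝ) (l : ℕ) (x : Fin (l + 1) → X)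
    (i : Fin (l + 1)) : cycle R l (fun j => x (j + i)) = cycle R l x := by
  rw [cycle_eq_prod, cycle_eq_prod,
    ← Equiv.prod_comp (Equiv.addRight i) fun j => R (x j) (x (j + 1))]
  simp only [Equiv.coe_addRight, add_right_comm]

variable {X : Type*} [MetricSpace X] [CompactSpace X] [MeasurableSpace X] [BorelSpace X]
  (μ : Measure X) [IsProbabilityMeasure μ] {R : X → X → ℝ}

theorem continuous_walk {X : Type*} [TopologicalSpace X] {R : X → X → ℝ}
    (hR : Continuous fun p : X × X => R p.1 p.2) (l : ℕ) :
    Continuous fun p : X × (Fin l → X) × X => walk R l p.1 p.2.1 p.2.2 := by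
  induction l with
  | zero => exact hR.comp (f := fun p : X × (Fin 0 → X) × X => (p.1, p.2.2)) (by fun_prop)
  | succ l ih =>
    refine (hR.comp (f := fun p : X × (Fin (l + 1) → X) × X => (p.1, p.2.1 0))
      (by fun_prop)).mul (ih.comp (f := fun p : X × (Fin (l + 1) → X) × X =>
      (p.2.1 0, Fin.tail p.2.1, p.2.2)) ?_)
    unfold Fin.tail
    fun_prop

theorem continuous_cycle {X : Type*} [TopologicalSpace X] {R : X → X → ℝ}
    (hR : Continuous fun p : X × X => R p.1 p.2) (l : ℕ) : Continuous (cycle R l) := by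
  refine (continuous_walk hR l).comp (f := fun x : Fin (l + 1) → X => (x 0, Fin.tail x, x 0)) ?_
  unfold Fin.tail
  fun_prop

theorem integral_pi_succ {l : ℕ} {F : (Fin (l + 1) → X) → ℝ} (hF : Continuous F) :
    ∫ x, F x ∂(Measure.pi fun _ => μ)
      = ∫ y, ∫ u, F (Fin.cons y u) ∂(Measure.pi fun _ => μ) ∂μ := by
  have h := (measurePreserving_piFinSuccAbove (fun _ : Fin (l + 1) => μ) 0).symm
  rw [← h.integral_comp' (f := (MeasurableEquiv.piFinSuccAbove (fun _ => X) 0).symm)]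
  rw [integral_prod]
  · simp [MeasurableEquiv.piFinSuccAbove, Fin.insertNthEquiv]
  · refine integrable_of_continuous _ (hF.comp (f := fun p : X × (Fin l → X) =>
      (MeasurableEquiv.piFinSuccAbove (fun _ => X) 0).symm p) ?_)
    simp only [MeasurableEquiv.piFinSuccAbove, Fin.insertNthEquiv]
    simp
    fun_prop

theorem integral_walk (hR : Continuous fun p : X × X => R p.1 p.2) (l : ℕ) (y w : X) :
    ∫ u, walk R l y u w ∂(Measure.pi fun _ => μ) = kpow μ R l y w := by
  induction l generalizing y with
  | zero => simp [walk, kpow]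
  | succ l ih =>
    rw [integral_pi_succ μ (F := fun u => walk R (l + 1) y u w) ((continuous_walk hR (l + 1)).comp
      (f := fun u : Fin (l + 1) → X => (y, u, w)) (by fun_prop))]
    simp only [walk, Fin.cons_zero, Fin.tail_cons, integral_const_mul, ih]
    rfl

theorem integral_walk_mul (hR : Continuous fun p : X × X => R p.1 p.2) {l : ℕ} (j : Fin l)
    {φ : X → ℝ} (hφ : Continuous φ) (y w : X) :
    ∫ u, walk R l y u w * φ (u j) ∂(Measure.pi fun _ => μ)
      = ∫ z, kpow μ R j y z * φ z * kpow μ R (l - 1 - j) z w ∂μ := by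
  induction l generalizing y with
  | zero => exact j.elim0
  | succ l ih =>
    rw [integral_pi_succ μ (F := fun u => walk R (l + 1) y u w * φ (u j))
      (((continuous_walk hR (l + 1)).comp
      (f := fun u : Fin (l + 1) → X => (y, u, w)) (by fun_prop)).mul (by fun_prop))]
    induction j using Fin.cases with
    | zero =>
      simp only [walk, Fin.cons_zero, Fin.tail_cons, integral_const_mul, integral_mul_const,
        integral_walk μ hR]
      refine integral_congr_ae (.of_forall fun z => ?_)
      simp [kpow]
      ring
    | succ j =>
      simp only [walk, Fin.cons_zero, Fin.tail_cons, Fin.cons_succ, mul_assoc,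
        integral_const_mul]
      simp only [ih j, ← integral_const_mul]
      have hj : l + 1 - 1 - (j.succ : ℕ) = l - 1 - j := by simp; omega
      rw [hj, integral_swap μ]
      · refine integral_congr_ae (.of_forall fun z => ?_)
        simp only [Fin.val_succ, kpow, kcomp, ← integral_mul_const]
        refine integral_congr_ae (.of_forall fun z' => ?_)
        ring
      · exact (hR.comp (f := fun q : X × X => (y, q.1)) (by fun_prop)).mul
          (((continuous_kpow μ hR j).mul (hφ.comp continuous_snd)).mul
          ((continuous_kpow μ hR (l - 1 - j)).comp (f := fun q : X × X => (q.2, w))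
          (by fun_prop)))

theorem integral_cycle (hR : Continuous fun p : X × X => R p.1 p.2) (l : ℕ) :
    ∫ x, cycle R l x ∂(Measure.pi fun _ => μ) = ∫ y, kpow μ R l y y ∂μ := by
  rw [integral_pi_succ μ (continuous_cycle hR l)]
  simp only [cycle, Fin.cons_zero, Fin.tail_cons, integral_walk μ hR]

theorem integral_cycle_mul_zero (hR : Continuous fun p : X × X => R p.1 p.2) {l : ℕ} (j : Fin l)
    {φ : X → X → ℝ} (hφ : Continuous fun p : X × X => φ p.1 p.2) :
    ∫ x, cycle R l x * φ (x 0) (x j.succ) ∂(Measure.pi fun _ => μ)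
      = ∫ y, ∫ z, kpow μ R j y z * φ y z * kpow μ R (l - 1 - j) z y ∂μ ∂μ := by
  rw [integral_pi_succ μ (F := fun x => cycle R l x * φ (x 0) (x j.succ))
    ((continuous_cycle hR l).mul (hφ.comp
    (f := fun x : Fin (l + 1) → X => (x 0, x j.succ)) (by fun_prop)))]
  simp only [cycle, Fin.cons_zero, Fin.tail_cons, Fin.cons_succ]
  refine integral_congr_ae (.of_forall fun y => ?_)
  exact integral_walk_mul μ hR j (φ := φ y) (hφ.comp (f := fun z => (y, z)) (by fun_prop)) y y

theorem integral_cycle_mul (hR : Continuous fun p : X × X => R p.1 p.2) {l : ℕ}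
    (i : Fin (l + 1)) (j : Fin l)
    {φ : X → X → ℝ} (hφ : Continuous fun p : X × X => φ p.1 p.2) :
    ∫ x, cycle R l x * φ (x i) (x (j.succ + i)) ∂(Measure.pi fun _ => μ)
      = ∫ y, ∫ z, kpow μ R j y z * φ y z * kpow μ R (l - 1 - j) z y ∂μ ∂μ := by
  rw [← integral_cycle_mul_zero μ hR j hφ]
  have h := measurePreserving_piCongrLeft (fun _ : Fin (l + 1) => μ) (Equiv.addRight i).symm
  rw [← h.integral_comp' (g := fun x => cycle R l x * φ (x 0) (x j.succ))]
  refine integral_congr_ae (.of_forall fun x => ?_)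
  have e : ∀ j, (MeasurableEquiv.piCongrLeft (fun _ => X) (Equiv.addRight i).symm) x j
      = x (j + i) := fun j => by
    rw [MeasurableEquiv.coe_piCongrLeft]
    simpa using Equiv.piCongrLeft_apply_apply (fun _ => X) (Equiv.addRight i).symm x (j + i)
  have e' : (MeasurableEquiv.piCongrLeft (fun _ => X) (Equiv.addRight i).symm) x
      = fun j => x (j + i) := funext e
  simp only [e', cycle_rotate, zero_add]

end Walk

section Cycles

open Filter Topology

variable {X : Type*} [MetricSpace X] [CompactSpace X] [MeasurableSpace X] [BorelSpace X]

theorem kcomp_kpow_kpow (μ : Measure X) [IsFiniteMeasure μ] {R : X → X → ℝ}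
    (hR : Continuous fun p : X × X => R p.1 p.2) (p r : ℕ) :
    kcomp μ (kpow μ R p) (kpow μ R r) = kpow μ R (p + 1 + r) := by
  induction p with
  | zero => rw [Nat.add_right_comm]; simp only [Nat.zero_add, kpow]
  | succ p ih =>
    rw [kpow_succ, kcomp_assoc μ hR (continuous_kpow μ hR p) (continuous_kpow μ hR r), ih,
      ← kpow_succ]
    congr 1
    omega

variable {μ : Measure X} [IsProbabilityMeasure μ] {σ : ℕ → X → X → ℝ} {C a b : ℝ}

/-- The squares of the iterated kernels do not concentrate on sets of small measure. -/
theorem KernelSeq.exists_integral_mul_sq_le (h : KernelSeq μ σ C a b) (p : ℕ) {δ : ℝ}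
    (hδ : 0 < δ) : ∀ᶠ δ' in 𝓝[>] (0 : ℝ), ∀ᶠ n in atTop, ∀ φ : X → X → ℝ,
      Continuous (fun p : X × X => φ p.1 p.2) → (∀ x y, 0 ≤ φ x y) → (∀ x y, φ x y ≤ 1) →
      ∫ x, ∫ y, φ x y ∂μ ∂μ ≤ δ' →
      ∫ x, ∫ y, φ x y * kpow μ (σ n) (p + 1) x y ^ 2 ∂μ ∂μ ≤ δ := by
  obtain ⟨N, hN⟩ := h.hsnorm_kpow_cauchy p (δ := √(δ / 4)) (by positivity)
  have hK (n : ℕ) := continuous_kpow μ (h.cont n) (p + 1)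
  obtain ⟨B, hB⟩ := (isCompact_range (hK N)).isBounded.exists_norm_le
  have hδ' : 0 < δ / (4 * (B ^ 2 + 1)) := by positivity
  filter_upwards [Ioo_mem_nhdsGT hδ'] with δ' hd'
  filter_upwards [eventually_ge_atTop N] with n hn φ hφ h0 h1 hint
  have hD : Continuous fun q : X × X => (fun x y => kpow μ (σ n) (p + 1) x y
      - kpow μ (σ N) (p + 1) x y) q.1 q.2 := (hK n).sub (hK N)
  have hs := pow_le_pow_left₀ (hsnorm_nonneg _ _) (hN n hn) 2
  rw [Real.sq_sqrt (by positivity), hsnorm_sq μ (R := fun x y => kpow μ (σ n) (p + 1) x y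
      - kpow μ (σ N) (p + 1) x y) hD] at hs
  have hpt (x y : X) : φ x y * kpow μ (σ n) (p + 1) x y ^ 2 ≤ 2 * B ^ 2 * φ x y
      + 2 * (kpow μ (σ n) (p + 1) x y - kpow μ (σ N) (p + 1) x y) ^ 2 := by
    have hb : |kpow μ (σ N) (p + 1) x y| ≤ B := hB _ ⟨(x, y), rfl⟩
    have hb2 := sq_le_sq' (abs_le.1 hb).1 (abs_le.1 hb).2
    have e1 := mul_le_mul_of_nonneg_left hb2 (h0 x y)
    have e2 := mul_le_mul_of_nonneg_right (h1 x y)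
      (sq_nonneg (kpow μ (σ n) (p + 1) x y - kpow μ (σ N) (p + 1) x y))
    have e3 := mul_nonneg (h0 x y)
      (sq_nonneg (kpow μ (σ n) (p + 1) x y - 2 * kpow μ (σ N) (p + 1) x y))
    nlinarith
  calc ∫ x, ∫ y, φ x y * kpow μ (σ n) (p + 1) x y ^ 2 ∂μ ∂μ
      = ∫ q, φ q.1 q.2 * kpow μ (σ n) (p + 1) q.1 q.2 ^ 2 ∂(μ.prod μ) :=
        (integral_prod_eq μ (F := fun x y => φ x y * kpow μ (σ n) (p + 1) x y ^ 2)
          (hφ.mul ((hK n).pow 2))).symm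
    _ ≤ ∫ q, (2 * B ^ 2 * φ q.1 q.2 + 2 * (kpow μ (σ n) (p + 1) q.1 q.2
          - kpow μ (σ N) (p + 1) q.1 q.2) ^ 2) ∂(μ.prod μ) :=
        integral_mono (integrable_of_continuous _ (hφ.mul ((hK n).pow 2)))
          (integrable_of_continuous _ ((hφ.const_mul _).add ((hD.pow 2).const_mul _)))
          fun q => hpt q.1 q.2
    _ = 2 * B ^ 2 * ∫ x, ∫ y, φ x y ∂μ ∂μ + 2 * ∫ x, ∫ y, (kpow μ (σ n) (p + 1) x y
          - kpow μ (σ N) (p + 1) x y) ^ 2 ∂μ ∂μ := by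
        have hD2 : Continuous fun q : X × X => 2 * (kpow μ (σ n) (p + 1) q.1 q.2
          - kpow μ (σ N) (p + 1) q.1 q.2) ^ 2 := (hD.pow 2).const_mul _
        rw [integral_add (integrable_of_continuous _ (hφ.const_mul _))
          (integrable_of_continuous _ hD2), integral_const_mul,
          integral_const_mul, integral_prod_eq μ hφ]
        congr 2
        exact integral_prod_eq μ (F := fun x y => (kpow μ (σ n) (p + 1) x y
          - kpow μ (σ N) (p + 1) x y) ^ 2) (hD.pow 2)
    _ ≤ 2 * B ^ 2 * (δ / (4 * (B ^ 2 + 1))) + 2 * (δ / 4) :=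
        add_le_add (mul_le_mul_of_nonneg_left (hint.trans hd'.2.le) (by positivity))
          (mul_le_mul_of_nonneg_left hs (by norm_num))
    _ ≤ δ := by
        have : B ^ 2 * (δ / (4 * (B ^ 2 + 1))) ≤ δ / 4 := by
          rw [← mul_div_assoc, div_le_div_iff₀ (by positivity) (by norm_num)]
          nlinarith
        linarith

theorem KernelSeq.integral_cycle_mul_le_of_sq (h : KernelSeq μ σ C a b) {n l : ℕ}
    (i : Fin (l + 1)) (s : Fin l) {φ : X → X → ℝ}
    (hφ : Continuous (fun p : X × X => φ p.1 p.2)) (h0 : ∀ x y, 0 ≤ φ x y) {δ : ℝ}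
    (h1 : ∫ x, ∫ y, φ x y * kpow μ (σ n) s x y ^ 2 ∂μ ∂μ ≤ δ)
    (h2 : ∫ x, ∫ y, φ x y * kpow μ (σ n) (l - 1 - s) x y ^ 2 ∂μ ∂μ ≤ δ) :
    ∫ x, cycle (σ n) l x * φ (x i) (x (s.succ + i)) ∂(Measure.pi fun _ => μ) ≤ δ := by
  have hK (r : ℕ) := continuous_kpow μ (h.cont n) r
  rw [integral_cycle_mul μ (h.cont n) i s hφ]
  have c1 : Continuous fun q : X × X => (fun x y => φ x y * kpow μ (σ n) s x y ^ 2) q.1 q.2 :=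
    hφ.mul ((hK _).pow 2)
  have c2 : Continuous fun q : X × X =>
      (fun x y => φ x y * kpow μ (σ n) (l - 1 - s) x y ^ 2) q.1 q.2 := hφ.mul ((hK _).pow 2)
  have c3 : Continuous fun q : X × X => (fun x y => kpow μ (σ n) s x y * φ x y
      * kpow μ (σ n) (l - 1 - s) y x) q.1 q.2 :=
    ((hK _).mul hφ).mul ((hK _).comp continuous_swap)
  rw [← integral_prod_eq μ c1] at h1
  rw [← integral_prod_eq μ c2] at h2
  rw [← integral_prod_eq μ c3]
  have : ∫ q, (fun x y => kpow μ (σ n) s x y * φ x y * kpow μ (σ n) (l - 1 - s) y x) q.1 q.2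
      ∂(μ.prod μ) ≤ ∫ q, ((fun x y => φ x y * kpow μ (σ n) s x y ^ 2) q.1 q.2
        + (fun x y => φ x y * kpow μ (σ n) (l - 1 - s) x y ^ 2) q.1 q.2) * 2⁻¹ ∂(μ.prod μ) := by
    refine integral_mono (integrable_of_continuous _ c3)
      (integrable_of_continuous _ ((c1.add c2).mul_const _)) fun q => ?_
    have := mul_nonneg (h0 q.1 q.2) (sq_nonneg (kpow μ (σ n) s q.1 q.2
      - kpow μ (σ n) (l - 1 - s) q.1 q.2))
    simp only [kpow_symm μ (h.cont n) (h.symm n) (l - 1 - s) q.2 q.1]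
    nlinarith
  rw [integral_mul_const, integral_add (integrable_of_continuous _ c1)
    (integrable_of_continuous _ c2)] at this
  linarith

theorem KernelSeq.integral_cycle_mul_le_of_adjacent (h : KernelSeq μ σ C a b) {n l : ℕ}
    (hl : 0 < l) (hpos : ∀ x y, 0 ≤ σ n x y) (i : Fin (l + 1)) {ψ : X → X → ℝ}
    (hψ : Continuous (fun p : X × X => ψ p.1 p.2)) {e : ℝ} (he : 0 ≤ e)
    (hle : ∀ x y, ψ x y * σ n x y ≤ e) :
    ∫ x, cycle (σ n) l x * ψ (x i) (x (i + 1)) ∂(Measure.pi fun _ => μ) ≤ e * C ^ l := by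
  obtain ⟨l, rfl⟩ := Nat.exists_eq_succ_of_ne_zero hl.ne'
  have hK (r : ℕ) := continuous_kpow μ (h.cont n) r
  have e1 : i + 1 = (0 : Fin l.succ).succ + i := by
    refine (add_comm i 1).trans ?_
    rfl
  have c3 : Continuous fun q : X × X => (fun x y => σ n x y * ψ x y * kpow μ (σ n) l y x) q.1 q.2 :=
    ((h.cont n).mul hψ).mul ((hK _).comp continuous_swap)
  rw [e1, integral_cycle_mul μ (h.cont n) i 0 hψ]
  simp only [Fin.val_zero, Nat.succ_eq_add_one, Nat.add_sub_cancel, Nat.sub_zero, kpow]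
  refine le_trans ?_ (mul_le_mul_of_nonneg_left
    (integral_kpow_le μ (h.cont n) h.C_nonneg (h.opBound n) l) he)
  rw [← integral_prod_eq μ c3, ← integral_prod_eq μ (hK l), ← integral_const_mul]
  refine integral_mono (integrable_of_continuous _ c3)
    (integrable_of_continuous _ ((hK l).const_mul _)) fun q => ?_
  simp only [kpow_symm μ (h.cont n) (h.symm n) l q.2 q.1]
  refine mul_le_mul_of_nonneg_right ?_ (kpow_nonneg μ hpos _ _ _)
  rw [mul_comm]
  exact hle _ _

theorem KernelSeq.le_integral_cycle (h : KernelSeq μ σ C a b) {n : ℕ} {c : ℝ} (hc : 0 < c)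
    (hm : c ≤ ∫ x, ∫ y, σ n x y ∂μ ∂μ) (m : ℕ) :
    (c ^ (m + 1)) ^ 2 ≤ ∫ x, cycle (σ n) (m + 1 + m) x ∂(Measure.pi fun _ => μ) := by
  rw [integral_cycle μ (h.cont n), ← kcomp_kpow_kpow μ (h.cont n)]
  refine (pow_le_pow_left₀ (by positivity) ((pow_le_l2norm_integral_kpow μ (h.cont n) (h.symm n)
    hc hm m).trans (l2norm_integral_le_hsnorm μ (continuous_kpow μ (h.cont n) m))) 2).trans
    (le_of_eq ?_)
  rw [hsnorm_sq μ (continuous_kpow μ (h.cont n) m)]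
  refine integral_congr_ae (.of_forall fun x => integral_congr_ae (.of_forall fun y => ?_))
  simp only [kpow_symm μ (h.cont n) (h.symm n) m y x, sq]

theorem cycle_nonneg {X : Type*} {R : X → X → ℝ} (hR : ∀ x y, 0 ≤ R x y) (l : ℕ)
    (x : Fin (l + 1) → X) : 0 ≤ cycle R l x := walk_nonneg hR l _ _ _

theorem KernelSeq.exists_approx_cycle (h : KernelSeq μ σ C a b) (hpos : ∀ n x y, 0 ≤ σ n x y)
    {c : ℝ} (hc : 0 < c) (hm : ∀ᶠ n in atTop, c ≤ ∫ x, ∫ y, σ n x y ∂μ ∂μ)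
    {ψ : X → X → ℝ} (hψ : Continuous (fun p : X × X => ψ p.1 p.2)) (hψ0 : ∀ x y, 0 ≤ ψ x y)
    {e : ℕ → ℝ}
    (he0 : ∀ n, 0 ≤ e n) (he : Tendsto e atTop (𝓝 0)) (hle : ∀ n x y, ψ x y * σ n x y ≤ e n)
    (m : ℕ) : ∃ δ > 0, ∀ φ : X → X → ℝ,
      Continuous (fun p : X × X => φ p.1 p.2) → (∀ x y, 0 ≤ φ x y) → (∀ x y, φ x y ≤ 1) →
      ∫ x, ∫ y, φ x y ∂μ ∂μ ≤ δ → ∀ η > 0, ∃ x : Fin (m + 1 + m + 1) → X,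
      ∑ i, ψ (x i) (x (i + 1)) < η ∧ ∀ i, ∀ s : Fin (m + 1 + m), 0 < (s : ℕ) →
        0 < m + 1 + m - 1 - s → φ (x i) (x (s.succ + i)) < 1 / 2 := by
  set l := m + 1 + m with hl
  set T := (c ^ (m + 1)) ^ 2 with hT
  have hT0 : 0 < T := by positivity
  set S : ℝ := (l + 1) * l with hS
  have hS0 : 0 < S := by
    have : (0 : ℝ) < l := by rw [hl]; positivity
    positivity
  have hev : ∀ᶠ δ' in 𝓝[>] (0 : ℝ), ∀ p ∈ Finset.range l, ∀ᶠ n in atTop, ∀ φ : X → X → ℝ,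
      Continuous (fun p : X × X => φ p.1 p.2) → (∀ x y, 0 ≤ φ x y) → (∀ x y, φ x y ≤ 1) →
      ∫ x, ∫ y, φ x y ∂μ ∂μ ≤ δ' →
      ∫ x, ∫ y, φ x y * kpow μ (σ n) (p + 1) x y ^ 2 ∂μ ∂μ ≤ T / (8 * S) :=
    (Finset.eventually_all _).2 fun p _ => h.exists_integral_mul_sq_le p (by positivity)
  obtain ⟨δ, hδ, hδ0⟩ := (hev.and self_mem_nhdsWithin).exists
  refine ⟨δ, hδ0, fun φ hφ h0 h1 hint η hη => ?_⟩
  have hδ' := (Finset.eventually_all _).2 hδ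
  have hlim : Tendsto (fun n => (l + 1 : ℝ) * (η⁻¹ * (e n * C ^ l))) atTop (𝓝 0) := by
    have := ((he.mul_const (C ^ l)).const_mul η⁻¹).const_mul (l + 1 : ℝ)
    simpa using this
  obtain ⟨n, hmn, hδn, hen⟩ := (hm.and (hδ'.and
    (hlim.eventually (gt_mem_nhds (by positivity : (0 : ℝ) < T / 2))))).exists
  by_contra! hcon
  set P : Measure (Fin (l + 1) → X) := Measure.pi fun _ => μ with hP
  set A : Finset (Fin l) := Finset.univ.filter fun s => 0 < (s : ℕ) ∧ 0 < l - 1 - s with hA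
  have hcyc := continuous_cycle (h.cont n) l
  have cψ (i : Fin (l + 1)) : Continuous fun x : Fin (l + 1) → X =>
      cycle (σ n) l x * ψ (x i) (x (i + 1)) :=
    hcyc.mul (hψ.comp (f := fun x : Fin (l + 1) → X => (x i, x (i + 1))) (by fun_prop))
  have cφ (i : Fin (l + 1)) (s : Fin l) : Continuous fun x : Fin (l + 1) → X =>
      cycle (σ n) l x * φ (x i) (x (s.succ + i)) :=
    hcyc.mul (hφ.comp (f := fun x : Fin (l + 1) → X => (x i, x (s.succ + i))) (by fun_prop))
  have hpt (x : Fin (l + 1) → X) : cycle (σ n) l x ≤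
      η⁻¹ * (∑ i, cycle (σ n) l x * ψ (x i) (x (i + 1)))
        + 2 * ∑ i, ∑ s ∈ A, cycle (σ n) l x * φ (x i) (x (s.succ + i)) := by
    have hM := cycle_nonneg (hpos n) l x
    simp only [← Finset.mul_sum]
    have hφ0 : 0 ≤ ∑ i, ∑ s ∈ A, φ (x i) (x (s.succ + i)) :=
      Finset.sum_nonneg fun i _ => Finset.sum_nonneg fun s _ => h0 _ _
    have hψs : 0 ≤ η⁻¹ * ∑ i, ψ (x i) (x (i + 1)) :=
      mul_nonneg (by positivity) (Finset.sum_nonneg fun i _ => hψ0 _ _)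
    have key : 1 ≤ η⁻¹ * (∑ i, ψ (x i) (x (i + 1)))
        + 2 * ∑ i, ∑ s ∈ A, φ (x i) (x (s.succ + i)) := by
      rcases le_or_gt η (∑ i, ψ (x i) (x (i + 1))) with h2 | h2
      · have : 1 ≤ η⁻¹ * ∑ i, ψ (x i) (x (i + 1)) := by
          rwa [← div_eq_inv_mul, one_le_div hη]
        linarith
      · obtain ⟨i, s, hs1, hs2, h3⟩ := hcon x h2
        have h4 : φ (x i) (x (s.succ + i)) ≤ ∑ s ∈ A, φ (x i) (x (s.succ + i)) :=
          Finset.single_le_sum (f := fun s : Fin l => φ (x i) (x (s.succ + i)))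
            (fun s _ => h0 _ _) (Finset.mem_filter.2 ⟨Finset.mem_univ _, hs1, hs2⟩)
        have h5 : ∑ s ∈ A, φ (x i) (x (s.succ + i)) ≤ ∑ i, ∑ s ∈ A, φ (x i) (x (s.succ + i)) :=
          Finset.single_le_sum (f := fun i => ∑ s ∈ A, φ (x i) (x (s.succ + i)))
            (fun i _ => Finset.sum_nonneg fun s _ => h0 _ _) (Finset.mem_univ i)
        linarith
    nlinarith
  have hsum := integral_mono (μ := P) (integrable_of_continuous _ hcyc)
    (integrable_of_continuous _ (by fun_prop)) hpt
  rw [integral_add (integrable_of_continuous _ (by fun_prop))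
    (integrable_of_continuous _ (by fun_prop)), integral_const_mul, integral_const_mul,
    integral_finsetSum _ fun i _ => integrable_of_continuous _ (cψ i),
    integral_finsetSum _ fun i _ => integrable_of_continuous _ (by fun_prop)] at hsum
  have hT' := h.le_integral_cycle hc hmn m
  have hadj : ∑ i, ∫ x, cycle (σ n) l x * ψ (x i) (x (i + 1)) ∂P ≤ (l + 1) * (e n * C ^ l) := by
    refine (Finset.sum_le_card_nsmul _ _ (e n * C ^ l) fun i _ =>
      h.integral_cycle_mul_le_of_adjacent (by omega) (hpos n) i hψ (he0 n) (hle n)).trans_eq ?_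
    simp
  have hnon : ∑ i, ∫ x, ∑ s ∈ A, cycle (σ n) l x * φ (x i) (x (s.succ + i)) ∂P
      ≤ S * (T / (8 * S)) := by
    have hi (i : Fin (l + 1)) : ∫ x, ∑ s ∈ A, cycle (σ n) l x * φ (x i) (x (s.succ + i)) ∂P
        ≤ l * (T / (8 * S)) := by
      rw [integral_finsetSum _ fun s _ => integrable_of_continuous _ (cφ i s)]
      refine (Finset.sum_le_card_nsmul _ _ (T / (8 * S)) fun s hs => ?_).trans ?_
      · obtain ⟨hs1, hs2⟩ := (Finset.mem_filter.1 hs).2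
        obtain ⟨p, hp⟩ := Nat.exists_eq_succ_of_ne_zero hs1.ne'
        obtain ⟨r, hr⟩ := Nat.exists_eq_succ_of_ne_zero hs2.ne'
        refine h.integral_cycle_mul_le_of_sq i s hφ h0 ?_ ?_
        · rw [hp]
          exact hδn p (Finset.mem_range.2 (by omega)) φ hφ h0 h1 hint
        · rw [hr]
          exact hδn r (Finset.mem_range.2 (by omega)) φ hφ h0 h1 hint
      · rw [nsmul_eq_mul]
        refine mul_le_mul_of_nonneg_right ?_ (by positivity)
        exact_mod_cast (Finset.card_le_univ A).trans_eq (Fintype.card_fin l)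
    refine (Finset.sum_le_card_nsmul _ _ _ fun i _ => hi i).trans_eq ?_
    simp [hS]
    ring
  have hS' : S * (T / (8 * S)) = T / 8 := by
    field_simp
  have hη' : η⁻¹ * ∑ i, ∫ x, cycle (σ n) l x * ψ (x i) (x (i + 1)) ∂P
      ≤ (l + 1 : ℝ) * (η⁻¹ * (e n * C ^ l)) :=
    (mul_le_mul_of_nonneg_left hadj (by positivity)).trans_eq (by ring)
  linarith

/-- If the kernels `σ n` concentrate on the zero set of `ψ`, there is a closed walk of
given even length along the zero set of `ψ` whose non-consecutive vertices are distinct. -/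
theorem KernelSeq.exists_cycle (h : KernelSeq μ σ C a b) (hpos : ∀ n x y, 0 ≤ σ n x y)
    {c : ℝ} (hc : 0 < c) (hm : ∀ᶠ n in atTop, c ≤ ∫ x, ∫ y, σ n x y ∂μ ∂μ)
    {ψ : X → X → ℝ} (hψ : Continuous (fun p : X × X => ψ p.1 p.2)) (hψ0 : ∀ x y, 0 ≤ ψ x y)
    {e : ℕ → ℝ} (he0 : ∀ n, 0 ≤ e n) (he : Tendsto e atTop (𝓝 0))
    (hle : ∀ n x y, ψ x y * σ n x y ≤ e n)
    (hφ : ∀ δ > 0, ∃ φ : X → X → ℝ, Continuous (fun p : X × X => φ p.1 p.2) ∧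
      (∀ x y, 0 ≤ φ x y) ∧ (∀ x y, φ x y ≤ 1) ∧ (∀ x, φ x x = 1) ∧ ∫ x, ∫ y, φ x y ∂μ ∂μ ≤ δ)
    (m : ℕ) : ∃ x : Fin (m + 1 + m + 1) → X, (∀ i, ψ (x i) (x (i + 1)) = 0) ∧
      ∀ i j, i ≠ j → j ≠ i + 1 → i ≠ j + 1 → x i ≠ x j := by
  obtain ⟨δ, hδ, H⟩ := h.exists_approx_cycle hpos hc hm hψ hψ0 he0 he hle m
  obtain ⟨φ, hφc, h0, h1, hφd, hint⟩ := hφ δ hδ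
  replace H := H φ hφc h0 h1 hint
  set K : Set (Fin (m + 1 + m + 1) → X) := {x | ∀ i, ∀ s : Fin (m + 1 + m), 0 < (s : ℕ) →
    0 < m + 1 + m - 1 - s → φ (x i) (x (s.succ + i)) ≤ 1 / 2} with hK
  have hKc : IsClosed K := by
    simp only [hK, ofPred_forall]
    refine isClosed_iInter fun i => isClosed_iInter fun s => isClosed_iInter fun _ =>
      isClosed_iInter fun _ => isClosed_le ?_ continuous_const
    exact hφc.comp (f := fun x : Fin (m + 1 + m + 1) → X => (x i, x (s.succ + i))) (by fun_prop)
  have hcont : Continuous fun x : Fin (m + 1 + m + 1) → X => ∑ i, ψ (x i) (x (i + 1)) :=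
    continuous_finsetSum _ fun i _ =>
      hψ.comp (f := fun x : Fin (m + 1 + m + 1) → X => (x i, x (i + 1))) (by fun_prop)
  have hne : K.Nonempty := by
    obtain ⟨x, -, hx⟩ := H 1 one_pos
    exact ⟨x, fun i s h1 h2 => (hx i s h1 h2).le⟩
  obtain ⟨x, hxK, hx⟩ := hKc.isCompact.exists_isMinOn hne hcont.continuousOn
  have hx0 : ∑ i, ψ (x i) (x (i + 1)) ≤ 0 := by
    by_contra! hlt
    obtain ⟨y, hy, hyK⟩ := H _ hlt
    exact (hx (show y ∈ K from fun i s h1 h2 => (hyK i s h1 h2).le)).not_gt hy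
  refine ⟨x, fun i => ?_, fun i j hij hj hi heq => ?_⟩
  · exact (Finset.sum_eq_zero_iff_of_nonneg fun i _ => hψ0 _ _).1
      (le_antisymm hx0 (Finset.sum_nonneg fun i _ => hψ0 _ _)) i (Finset.mem_univ i)
  · obtain ⟨s, hs⟩ := Fin.exists_succ_eq.2 (sub_ne_zero.2 hij.symm)
    have hjs : s.succ + i = j := by rw [hs, sub_add_cancel]
    have := hxK i s (Nat.pos_of_ne_zero fun h0 => hj ?_) (Nat.pos_of_ne_zero fun h0 => hi ?_)
    · rw [hjs, ← heq, hφd] at this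
      norm_num at this
    · have : s = ⟨0, by omega⟩ := Fin.ext h0
      rw [← hjs, this]
      refine (add_comm _ i).trans (congrArg (i + ·) (Fin.ext ?_))
      simp
    · have : s.succ = Fin.last _ := Fin.ext (by have := s.2; simp; omega)
      rw [← hjs, this]
      exact ((add_right_comm (Fin.last _) i 1).trans
        (by rw [Fin.last_add_one]; exact zero_add i)).symm

end Cycles

section Lorentz

open Filter Topology

/-- The Lorentzian bump of width `ε`. -/
noncomputable def lorentz (ε r : ℝ) : ℝ := ε / (ε ^ 2 + r ^ 2)

theorem lorentz_nonneg {ε : ℝ} (hε : 0 ≤ ε) (r : ℝ) : 0 ≤ lorentz ε r := by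
  unfold lorentz
  positivity

theorem lorentz_le {ε : ℝ} (hε : 0 < ε) (r : ℝ) : lorentz ε r ≤ ε⁻¹ := by
  rw [lorentz, div_le_iff₀ (by positivity), inv_mul_eq_div, le_div_iff₀ hε]
  nlinarith [sq_nonneg r]

theorem sq_mul_lorentz_le {ε : ℝ} (hε : 0 < ε) (r : ℝ) : r ^ 2 * lorentz ε r ≤ ε := by
  rw [lorentz, ← mul_div_assoc, div_le_iff₀ (by positivity)]
  nlinarith [pow_pos hε 3]

theorem le_lorentz {ε r : ℝ} (hε : 0 < ε) (hr : |r| ≤ ε) : (2 * ε)⁻¹ ≤ lorentz ε r := by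
  have : r ^ 2 ≤ ε ^ 2 := sq_le_sq' (abs_le.1 hr).1 (abs_le.1 hr).2
  rw [lorentz, inv_eq_one_div, div_le_div_iff₀ (by positivity) (by positivity)]
  nlinarith

theorem continuous_lorentz {ε : ℝ} (hε : 0 < ε) : Continuous (lorentz ε) := by
  unfold lorentz
  exact continuous_const.div (by fun_prop) fun r => by positivity

theorem lorentz_eq_integral {ε : ℝ} (hε : 0 < ε) (r : ℝ) :
    lorentz ε r = ∫ τ in Ioi (0 : ℝ), Real.exp (-ε * τ) * Real.cos (τ * r) := by
  have ha : (-(ε : ℂ) + r * Complex.I).re < 0 := by simpa using hε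
  have h1 := integral_exp_mul_complex_Ioi ha 0
  have h2 := integral_re (integrableOn_exp_mul_complex_Ioi ha 0)
  rw [h1] at h2
  have e (τ : ℝ) : RCLike.re (Complex.exp ((-(ε : ℂ) + r * Complex.I) * τ))
      = Real.exp (-ε * τ) * Real.cos (τ * r) := by
    change (Complex.exp _).re = _
    rw [Complex.exp_re]
    simp [mul_comm]
  simp only [e] at h2
  rw [h2]
  change _ = Complex.re _
  simp [lorentz, Complex.div_re, Complex.normSq_apply]
  ring

variable {X : Type*} [MetricSpace X] [CompactSpace X] [MeasurableSpace X] [BorelSpace X]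
  (μ : Measure X) [IsFiniteMeasure μ]

theorem OpBound.of_fourier {w : ℝ → ℝ} (hw : Continuous w) (hwi : IntegrableOn w (Ioi 0))
    {q : X → X → ℝ} (hq : Continuous fun p : X × X => q p.1 p.2) {b : ℝ → ℝ}
    (hb : ∀ τ > 0, OpBound μ (fun x y => Real.cos (τ * q x y)) (b τ)) {u : ℝ → ℝ}
    (hu : IntegrableOn u (Ioi 0)) (hwu : ∀ τ > 0, |w τ| * b τ ≤ u τ) {S : X → X → ℝ}
    (hSc : Continuous fun p : X × X => S p.1 p.2)
    (hS : ∀ x y, S x y = ∫ τ in Ioi 0, w τ * Real.cos (τ * q x y)) :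
    OpBound μ S (∫ τ in Ioi 0, u τ) := by
  intro f g hf hg
  have hF : Continuous fun p : X × X => (fun x y => S x y * f y * g x) p.1 p.2 :=
    (hSc.mul (hf.comp continuous_snd)).mul (hg.comp continuous_fst)
  have hcos (τ : ℝ) : Continuous fun p : X × X =>
      (fun x y => Real.cos (τ * q x y) * f y * g x) p.1 p.2 :=
    ((Real.continuous_cos.comp (hq.const_mul τ)).mul (hf.comp continuous_snd)).mul
      (hg.comp continuous_fst)
  have hfg : Continuous fun p : X × X => f p.2 * g p.1 := by fun_prop
  obtain ⟨B, hB⟩ := (isCompact_range hfg).isBounded.exists_norm_le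
  have hint : Integrable (fun z : (X × X) × ℝ =>
      w z.2 * (Real.cos (z.2 * q z.1.1 z.1.2) * f z.1.2 * g z.1.1))
      ((μ.prod μ).prod (volume.restrict (Ioi 0))) := by
    have h1 : Integrable (fun z : (X × X) × ℝ => B * ‖w z.2‖)
        ((μ.prod μ).prod (volume.restrict (Ioi 0))) := (hwi.norm.const_mul B).comp_snd (μ.prod μ)
    refine h1.mono' ?_ (.of_forall fun z => ?_)
    · have : Continuous fun z : (X × X) × ℝ =>
          w z.2 * (Real.cos (z.2 * q z.1.1 z.1.2) * f z.1.2 * g z.1.1) := by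
        have := hq.comp (f := fun z : (X × X) × ℝ => z.1) (by fun_prop)
        simp only [Function.comp_def] at this
        fun_prop
      exact this.aestronglyMeasurable
    · rw [norm_mul, mul_comm, mul_assoc, norm_mul]
      refine mul_le_mul_of_nonneg_right ?_ (norm_nonneg _)
      exact (mul_le_of_le_one_left (norm_nonneg _) (Real.abs_cos_le_one _)).trans
        (hB _ ⟨z.1, rfl⟩)
  have e1 : ∫ x, (∫ y, S x y * f y ∂μ) * g x ∂μ
      = ∫ τ in Ioi 0, w τ * ∫ x, (∫ y, Real.cos (τ * q x y) * f y ∂μ) * g x ∂μ := by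
    simp only [← integral_mul_const]
    rw [← integral_prod_eq μ hF]
    have : ∀ p : X × X, (fun x y => S x y * f y * g x) p.1 p.2 = ∫ τ in Ioi 0,
        w τ * (Real.cos (τ * q p.1 p.2) * f p.2 * g p.1) := fun p => by
      simp only [hS, ← integral_mul_const]
      simp only [mul_assoc]
    simp only [this]
    rw [integral_integral_swap hint]
    refine integral_congr_ae (.of_forall fun τ => ?_)
    simp only [integral_const_mul]
    congr 1
    exact integral_prod_eq μ (F := fun x y => Real.cos (τ * q x y) * f y * g x) (hcos τ)
  rw [e1, mul_assoc, ← integral_mul_const]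
  rw [← Real.norm_eq_abs]
  refine norm_integral_le_of_norm_le (Integrable.mul_const hu _) ?_
  filter_upwards [ae_restrict_mem measurableSet_Ioi] with τ hτ
  rw [norm_mul]
  refine (mul_le_mul_of_nonneg_left (hb τ hτ f g hf hg) (norm_nonneg _)).trans ?_
  rw [mul_assoc, ← mul_assoc]
  exact mul_le_mul_of_nonneg_right (hwu τ hτ) (mul_nonneg (l2norm_nonneg _ _) (l2norm_nonneg _ _))

end Lorentz

section Oscillation

open Filter Topology

variable {X : Type*} [MetricSpace X] [MeasurableSpace X] (μ : Measure X)

theorem OpBound.mono {R : X → X → ℝ} {C D : ℝ} (h : OpBound μ R C) (hCD : C ≤ D) :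
    OpBound μ R D := fun f g hf hg => (h f g hf hg).trans <|
  mul_le_mul_of_nonneg_right (mul_le_mul_of_nonneg_right hCD (l2norm_nonneg _ _))
    (l2norm_nonneg _ _)

theorem OpBound.abs_integral_le [IsProbabilityMeasure μ] {R : X → X → ℝ} {C : ℝ}
    (h : OpBound μ R C) : |∫ x, ∫ y, R x y ∂μ ∂μ| ≤ C := by
  simpa [l2norm_const] using h (fun _ => 1) (fun _ => 1) continuous_const continuous_const

variable [CompactSpace X] [BorelSpace X] [IsProbabilityMeasure μ] {q : X → X → ℝ} {b : ℝ → ℝ}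

theorem opBound_lorentz (hq : Continuous fun p : X × X => q p.1 p.2)
    (hb0 : ∀ τ > 0, 0 ≤ b τ) (hbi : IntegrableOn b (Ioi 0))
    (hb : ∀ τ > 0, OpBound μ (fun x y => Real.cos (τ * q x y)) (b τ)) {ε : ℝ} (hε : 0 < ε) :
    OpBound μ (fun x y => lorentz ε (q x y)) (∫ τ in Ioi 0, b τ) := by
  refine OpBound.of_fourier μ (w := fun τ => Real.exp (-ε * τ)) (by fun_prop)
    (exp_neg_integrableOn_Ioi 0 hε) hq hb hbi (fun τ hτ => ?_)
    ((continuous_lorentz hε).comp hq) (fun x y => lorentz_eq_integral hε _)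
  rw [abs_of_pos (Real.exp_pos _)]
  refine mul_le_of_le_one_left (hb0 τ hτ) (Real.exp_le_one_iff.2 ?_)
  nlinarith

theorem abs_exp_sub_exp_le_rpow {s t θ : ℝ} (hs : 0 ≤ s) (hst : s ≤ t) (hθ : 0 ≤ θ)
    (hθ1 : θ ≤ 1) : |Real.exp (-s) - Real.exp (-t)| ≤ t ^ θ := by
  have h1 : Real.exp (-s) ≤ 1 := Real.exp_le_one_iff.2 (by linarith)
  have h2 : Real.exp (-t) ≤ Real.exp (-s) := Real.exp_le_exp.2 (by linarith)
  have h3 := Real.add_one_le_exp (-t)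
  have h4 := Real.exp_pos (-t)
  rw [abs_of_nonneg (by linarith)]
  have ht := hs.trans hst
  rcases le_total t 1 with h | h
  · have : t ^ (1 : ℝ) ≤ t ^ θ := Real.rpow_le_rpow_of_exponent_ge' ht h hθ hθ1
    rw [Real.rpow_one] at this
    linarith
  · have := Real.one_le_rpow h hθ
    linarith

theorem opBound_lorentz_sub (hq : Continuous fun p : X × X => q p.1 p.2)
    (hb0 : ∀ τ > 0, 0 ≤ b τ) {θ : ℝ} (hθ : 0 ≤ θ) (hθ1 : θ ≤ 1)
    (hbi : IntegrableOn (fun τ => τ ^ θ * b τ) (Ioi 0))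
    (hb : ∀ τ > 0, OpBound μ (fun x y => Real.cos (τ * q x y)) (b τ)) {ε ε' : ℝ} (hε' : 0 < ε')
    (h : ε' ≤ ε) : OpBound μ (fun x y => lorentz ε' (q x y) - lorentz ε (q x y))
      (ε ^ θ * ∫ τ in Ioi 0, τ ^ θ * b τ) := by
  have hε := hε'.trans_le h
  rw [← integral_const_mul]
  refine OpBound.of_fourier μ (w := fun τ => Real.exp (-ε' * τ) - Real.exp (-ε * τ))
    (by fun_prop) ((exp_neg_integrableOn_Ioi 0 hε').sub (exp_neg_integrableOn_Ioi 0 hε)) hq hb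
    (Integrable.const_mul hbi _) (fun τ hτ => ?_)
    (((continuous_lorentz hε').comp hq).sub ((continuous_lorentz hε).comp hq)) (fun x y => ?_)
  · rw [← mul_assoc, ← Real.mul_rpow hε.le hτ.le, neg_mul, neg_mul]
    exact mul_le_mul_of_nonneg_right (abs_exp_sub_exp_le_rpow (mul_pos hε' hτ).le
      (mul_le_mul_of_nonneg_right h hτ.le) hθ hθ1) (hb0 τ hτ)
  · have hi {ε : ℝ} (hε : 0 < ε) : IntegrableOn (fun τ => Real.exp (-ε * τ) *
        Real.cos (τ * q x y)) (Ioi 0) := by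
      refine Integrable.mono' (exp_neg_integrableOn_Ioi 0 hε)
        (by fun_prop) (.of_forall fun τ => ?_)
      rw [norm_mul, Real.norm_of_nonneg (Real.exp_pos _).le]
      exact mul_le_of_le_one_right (Real.exp_pos _).le (Real.abs_cos_le_one _)
    simp only [sub_mul]
    rw [integral_sub (hi hε') (hi hε), ← lorentz_eq_integral hε', ← lorentz_eq_integral hε]

theorem exists_le_integral_lorentz {q0 : X → X → ℝ}
    (hq : Continuous fun p : X × X => q0 p.1 p.2) (h0 : ∀ x y, 0 ≤ q0 x y) {R : ℝ}
    (hR : ∀ x y, q0 x y ≤ R) (hR0 : 0 ≤ R) {ε : ℝ} (hε : 0 < ε) (hε1 : ε ≤ 1) :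
    ∃ v > 0, (2 * (R + 1))⁻¹ ≤ ∫ x, ∫ y, lorentz ε (q0 x y - v) ∂μ ∂μ := by
  set N := ⌊R / ε⌋₊ + 1
  have hN : (N : ℝ) ≤ R / ε + 1 := by
    push_cast [N]
    linarith [Nat.floor_le (div_nonneg hR0 hε.le)]
  have hN0 : (0 : ℝ) < N := by positivity
  have hc (v : ℝ) : Continuous fun p : X × X => lorentz ε (q0 p.1 p.2 - v) :=
    (continuous_lorentz hε).comp (hq.sub continuous_const)
  have hpt (p : X × X) : (2 * ε)⁻¹ ≤
      ∑ i ∈ Finset.range N, lorentz ε (q0 p.1 p.2 - (i + 1) * ε) := by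
    set i := ⌊q0 p.1 p.2 / ε⌋₊
    have hi : i ∈ Finset.range N := by
      rw [Finset.mem_range]
      exact Nat.lt_succ_of_le (Nat.floor_mono (div_le_div_of_nonneg_right (hR _ _) hε.le))
    refine le_trans ?_ (Finset.single_le_sum (fun j _ => lorentz_nonneg hε.le _) hi)
    refine le_lorentz hε (abs_le.2 ?_)
    have h1 := Nat.floor_le (div_nonneg (h0 p.1 p.2) hε.le)
    have h2 := Nat.lt_floor_add_one (q0 p.1 p.2 / ε)
    rw [le_div_iff₀ hε] at h1
    rw [div_lt_iff₀ hε] at h2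
    constructor <;> linarith
  have hsum : (2 * ε)⁻¹ ≤ ∑ i ∈ Finset.range N,
      ∫ x, ∫ y, lorentz ε (q0 x y - (i + 1) * ε) ∂μ ∂μ := by
    have e (i : ℕ) : ∫ x, ∫ y, lorentz ε (q0 x y - (i + 1) * ε) ∂μ ∂μ
        = ∫ p, lorentz ε (q0 p.1 p.2 - (i + 1) * ε) ∂μ.prod μ :=
      (integral_prod_eq μ (F := fun x y => lorentz ε (q0 x y - (i + 1) * ε)) (hc _)).symm
    simp only [e]
    rw [← integral_finsetSum _ fun i _ => integrable_of_continuous _ (hc _)]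
    have := integral_mono (μ := μ.prod μ) (integrable_const (2 * ε)⁻¹)
      (integrable_of_continuous _ (continuous_finsetSum _ fun i _ => hc _)) hpt
    simpa using this
  by_contra! hcon
  have : ∑ i ∈ Finset.range N, ∫ x, ∫ y, lorentz ε (q0 x y - (i + 1) * ε) ∂μ ∂μ
      < ∑ i ∈ Finset.range N, (2 * (R + 1))⁻¹ :=
    Finset.sum_lt_sum_of_nonempty ⟨0, by simp [N]⟩ fun i _ => hcon _ (by positivity)
  rw [Finset.sum_const, Finset.card_range, nsmul_eq_mul] at this
  have h3 : (N : ℝ) * (2 * (R + 1))⁻¹ ≤ (2 * ε)⁻¹ := by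
    rw [← div_eq_mul_inv, div_le_iff₀ (by positivity), inv_mul_eq_div, le_div_iff₀ (by positivity)]
    have : (N : ℝ) * ε ≤ R + ε := by
      have := mul_le_mul_of_nonneg_right hN hε.le
      rwa [add_mul, div_mul_cancel₀ _ hε.ne', one_mul] at this
    linarith
  linarith

theorem exists_cycles_of_opBound {q0 : X → X → ℝ}
    (hq : Continuous fun p : X × X => q0 p.1 p.2) (hs : ∀ x y, q0 x y = q0 y x)
    (h0 : ∀ x y, 0 ≤ q0 x y) (hd : ∀ x, q0 x x = 0)
    (hb0 : ∀ τ > 0, 0 ≤ b τ) (hbi : IntegrableOn b (Ioi 0)) {θ : ℝ} (hθ : 1 / 2 < θ)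
    (hθ1 : θ ≤ 1) (hbθ : IntegrableOn (fun τ => τ ^ θ * b τ) (Ioi 0))
    (hb : ∀ v, ∀ τ > 0, OpBound μ (fun x y => Real.cos (τ * (q0 x y - v))) (b τ))
    (hφ : ∀ δ > 0, ∃ φ : X → X → ℝ, Continuous (fun p : X × X => φ p.1 p.2) ∧
      (∀ x y, 0 ≤ φ x y) ∧ (∀ x y, φ x y ≤ 1) ∧ (∀ x, φ x x = 1) ∧ ∫ x, ∫ y, φ x y ∂μ ∂μ ≤ δ) :
    ∃ v₁ v₂ : ℝ, 0 ≤ v₁ ∧ v₁ < v₂ ∧ ∀ v ∈ Ioo v₁ v₂, ∀ m : ℕ,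
      ∃ x : Fin (m + 1 + m + 1) → X, (∀ i, q0 (x i) (x (i + 1)) = v) ∧ Function.Injective x := by
  obtain ⟨R, hR⟩ := (isCompact_range hq).isBounded.exists_norm_le
  have hR' (x y : X) : q0 x y ≤ R := (le_abs_self _).trans (hR _ ⟨(x, y), rfl⟩)
  have hR0 : 0 ≤ R := by
    have : Nonempty X := μ.nonempty_of_neZero
    exact (h0 (Classical.arbitrary X) (Classical.arbitrary X)).trans (hR' _ _)
  set c := (2 * (R + 1))⁻¹ with hc
  have hcpos : 0 < c := by positivity
  set M := ∫ τ in Ioi 0, τ ^ θ * b τ with hM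
  have hM0 : 0 ≤ M := setIntegral_nonneg measurableSet_Ioi fun τ hτ =>
    mul_nonneg (Real.rpow_nonneg (le_of_lt hτ) _) (hb0 τ hτ)
  set B := ∫ τ in Ioi 0, b τ with hB
  have hB0 : 0 ≤ B := setIntegral_nonneg measurableSet_Ioi hb0
  set ε : ℕ → ℝ := fun n => (1 / 2) ^ n with hεdef
  have hε (n : ℕ) : 0 < ε n := by positivity
  have hεanti : Antitone ε := pow_right_anti₀ (by norm_num) (by norm_num)
  have hεlim : Tendsto ε atTop (𝓝 0) :=
    tendsto_pow_atTop_nhds_zero_of_lt_one (by norm_num) (by norm_num)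
  have hlim : Tendsto (fun n => ε n ^ θ * M) atTop (𝓝 0) := by
    have := (hεlim.rpow_const (p := θ) (.inr (by linarith))).mul_const M
    rwa [Real.zero_rpow (by linarith), zero_mul] at this
  obtain ⟨n, hn⟩ := (hlim.eventually_lt_const (show 0 < c / 4 by positivity)).exists
  have hqv (v : ℝ) : Continuous fun p : X × X => q0 p.1 p.2 - v := hq.sub continuous_const
  have hcv (v : ℝ) (n : ℕ) : Continuous fun p : X × X => lorentz (ε n) (q0 p.1 p.2 - v) :=
    (continuous_lorentz (hε n)).comp (hqv v)
  obtain ⟨v₀, hv₀, hG⟩ := exists_le_integral_lorentz μ hq h0 hR' hR0 (hε n)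
    (pow_le_one₀ (by norm_num) (by norm_num))
  have hGc : Continuous fun v => ∫ x, ∫ y, lorentz (ε n) (q0 x y - v) ∂μ ∂μ := by
    have h1 : Continuous fun v => ∫ p, lorentz (ε n) (q0 p.1 p.2 - v) ∂μ.prod μ :=
      continuous_integral (μ.prod μ) (F := fun v p => lorentz (ε n) (q0 p.1 p.2 - v))
        ((continuous_lorentz (hε n)).comp ((hq.comp continuous_snd).sub continuous_fst))
    convert h1 using 2 with v
    exact (integral_prod_eq μ (F := fun x y => lorentz (ε n) (q0 x y - v)) (hcv v n)).symm
  have hev : ∀ᶠ v in 𝓝 v₀, 0 < v ∧ c / 2 < ∫ x, ∫ y, lorentz (ε n) (q0 x y - v) ∂μ ∂μ :=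
    (lt_mem_nhds hv₀).and (hGc.continuousAt.eventually_const_lt (by linarith))
  obtain ⟨v₁, v₂, ⟨hv1, hv2⟩, hsub⟩ := mem_nhds_iff_exists_Ioo_subset.1 hev
  refine ⟨max v₁ 0, v₂, le_max_right _ _, max_lt (hv1.trans hv2) (hv₀.trans hv2),
    fun v hv m => ?_⟩
  obtain ⟨hvpos, hGv⟩ := hsub ⟨(le_max_left _ _).trans_lt hv.1, hv.2⟩
  have hmass : ∀ᶠ n' in atTop, c / 4 ≤ ∫ x, ∫ y, lorentz (ε n') (q0 x y - v) ∂μ ∂μ := by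
    filter_upwards [eventually_ge_atTop n] with n' hn'
    have h1 := (opBound_lorentz_sub μ (hqv v) hb0 (by linarith) hθ1 hbθ (hb v) (hε n')
      (hεanti hn')).abs_integral_le
    rw [← integral_prod_eq μ (F := fun x y => lorentz (ε n') (q0 x y - v) -
      lorentz (ε n) (q0 x y - v)) ((hcv v n').sub (hcv v n)),
      integral_sub (integrable_of_continuous _ (hcv v n')) (integrable_of_continuous _ (hcv v n)),
      integral_prod_eq μ (F := fun x y => lorentz (ε n') (q0 x y - v)) (hcv v n'),
      integral_prod_eq μ (F := fun x y => lorentz (ε n) (q0 x y - v)) (hcv v n)] at h1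
    linarith [(abs_le.1 h1).1]
  have hK : KernelSeq μ (fun n x y => lorentz (ε n) (q0 x y - v)) (max (max B M) √B)
      ((1 / 2) ^ θ) √2 := by
    refine ⟨hcv v, fun n x y => by rw [hs], (Real.sqrt_nonneg _).trans (le_max_right _ _),
      by positivity, Real.one_le_sqrt.2 (by norm_num), ?_, fun n => ?_, fun n => ?_, fun n => ?_⟩
    · rw [Real.sqrt_eq_rpow, one_div, Real.inv_rpow (by norm_num), ← Real.rpow_neg (by norm_num),
        ← Real.rpow_add (by norm_num)]
      exact Real.rpow_lt_one_of_one_lt_of_neg (by norm_num) (by linarith)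
    · exact (opBound_lorentz μ (hqv v) hb0 hbi (hb v) (hε n)).mono _
        ((le_max_left _ _).trans (le_max_left _ _))
    · refine (opBound_lorentz_sub μ (hqv v) hb0 (by linarith) hθ1 hbθ (hb v) (hε (n + 1))
        (hεanti n.le_succ)).mono _ ?_
      rw [← hM, mul_comm, hεdef]
      have : ((1 / 2 : ℝ) ^ n) ^ θ = ((1 / 2) ^ θ) ^ n := by
        rw [← Real.rpow_natCast, ← Real.rpow_natCast, ← Real.rpow_mul (by norm_num),
          ← Real.rpow_mul (by norm_num), mul_comm]
      simp only [this]
      exact mul_le_mul_of_nonneg_right ((le_max_right _ _).trans (le_max_left _ _)) (by positivity)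
    · have h1 : hsnorm μ (fun x y => lorentz (ε n) (q0 x y - v)) ^ 2 ≤ (√B * √2 ^ n) ^ 2 := by
        rw [hsnorm_sq μ (R := fun x y => lorentz (ε n) (q0 x y - v)) (hcv v n),
          ← integral_prod_eq μ (F := fun x y => lorentz (ε n) (q0 x y - v) ^ 2) ((hcv v n).pow 2)]
        have h2 := (abs_le.1 (opBound_lorentz μ (hqv v) hb0 hbi (hb v) (hε n)).abs_integral_le).2
        rw [← integral_prod_eq μ (F := fun x y => lorentz (ε n) (q0 x y - v)) (hcv v n)] at h2
        have h3 : ∫ p, lorentz (ε n) (q0 p.1 p.2 - v) ^ 2 ∂μ.prod μ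
            ≤ ∫ p, 2 ^ n * lorentz (ε n) (q0 p.1 p.2 - v) ∂μ.prod μ := by
          refine integral_mono (integrable_of_continuous _ ((hcv v n).pow 2))
            (integrable_of_continuous _ ((hcv v n).const_mul _)) fun p => ?_
          have := lorentz_le (hε n) (q0 p.1 p.2 - v)
          have e : (ε n)⁻¹ = 2 ^ n := by simp [hεdef]
          rw [e] at this
          simp only [sq]
          exact mul_le_mul_of_nonneg_right this (lorentz_nonneg (hε n).le _)
        rw [integral_const_mul] at h3
        refine h3.trans ?_
        rw [mul_pow, Real.sq_sqrt hB0, ← pow_mul, mul_comm n 2, pow_mul,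
          Real.sq_sqrt (by norm_num), mul_comm]
        exact mul_le_mul_of_nonneg_right h2 (by positivity)
      refine (abs_le_of_sq_le_sq' h1 (by positivity)).2.trans ?_
      exact mul_le_mul_of_nonneg_right (le_max_right _ _) (by positivity)
  obtain ⟨x, hx, hne⟩ := hK.exists_cycle (fun n x y => lorentz_nonneg (hε n).le _)
    (by positivity : 0 < c / 4) hmass (ψ := fun x y => (q0 x y - v) ^ 2) ((hqv v).pow 2)
    (fun x y => sq_nonneg _) (fun n => (hε n).le) hεlim
    (fun n x y => sq_mul_lorentz_le (hε n) _) hφ m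
  have hx' (i) : q0 (x i) (x (i + 1)) = v := by
    have := hx i
    simp only [pow_eq_zero_iff two_ne_zero] at this
    linarith
  have hadj (i) : x i ≠ x (i + 1) := fun h => by
    have := hx' i
    rw [← h, hd] at this
    exact hvpos.ne this
  refine ⟨x, hx', fun i j hij => ?_⟩
  by_contra hne'
  by_cases h1 : j = i + 1
  · exact hadj i (h1 ▸ hij)
  by_cases h2 : i = j + 1
  · exact hadj j (h2 ▸ hij.symm)
  exact hne i j hne' h1 h2 hij

end Oscillation

section Extension

open Filter Topology Complex
open scoped InnerProductSpace ComplexConjugate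

theorem sq_norm_integral_smul_le {α : Type*} [MeasurableSpace α] (ν : Measure α) {w : α → ℝ}
    (hw0 : ∀ a, 0 ≤ w a) (hw : Integrable w ν) {G : α → ℂ}
    (h1 : Integrable (fun a => w a * ‖G a‖) ν) (h2 : Integrable (fun a => w a * ‖G a‖ ^ 2) ν) :
    ‖∫ a, w a * G a ∂ν‖ ^ 2 ≤ (∫ a, w a ∂ν) * ∫ a, w a * ‖G a‖ ^ 2 ∂ν := by
  have key (t : ℝ) : 0 ≤ (∫ a, w a ∂ν) * (t * t) + (-2 * ∫ a, w a * ‖G a‖ ∂ν) * t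
      + ∫ a, w a * ‖G a‖ ^ 2 ∂ν := by
    have : 0 ≤ ∫ a, w a * (t - ‖G a‖) ^ 2 ∂ν :=
      integral_nonneg fun a => mul_nonneg (hw0 a) (sq_nonneg _)
    have e : (fun a => w a * (t - ‖G a‖) ^ 2)
        = fun a => (t * t) * w a + (-2 * t) * (w a * ‖G a‖) + w a * ‖G a‖ ^ 2 := by
      funext a; ring
    have hi : Integrable (fun a => (t * t) * w a + (-2 * t) * (w a * ‖G a‖)) ν :=
      (hw.const_mul _).add (h1.const_mul _)
    rw [e, integral_add hi h2, integral_add (hw.const_mul _) (h1.const_mul _),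
      integral_const_mul, integral_const_mul] at this
    linarith
  have hd := discrim_le_zero key
  rw [discrim] at hd
  have hn : ‖∫ a, w a * G a ∂ν‖ ≤ ∫ a, w a * ‖G a‖ ∂ν := by
    refine (norm_integral_le_integral_norm _).trans (le_of_eq ?_)
    exact integral_congr_ae (.of_forall fun a => by simp [abs_of_nonneg (hw0 a)])
  have := pow_le_pow_left₀ (norm_nonneg _) hn 2
  nlinarith

variable {V : Type*} [NormedAddCommGroup V] [InnerProductSpace ℝ V]

variable {X : Type*} [MetricSpace X] [CompactSpace X] [MeasurableSpace X] [BorelSpace X]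
  (μ : Measure X) [IsFiniteMeasure μ] {e : X → V} {C s : ℝ}

theorem integral_gauss_le (he : Continuous e)
    (hF : ∀ x, ∀ l > 0, ∫ y, Real.exp (-(l ^ 2 * ‖e x - e y‖ ^ 2)) ∂μ ≤ C * l ^ (-s))
    {R : ℝ} (hR : ∀ x, ‖e x‖ ≤ R) {l : ℝ} (hl : 1 ≤ l) (hC : 0 ≤ C) (ξ : V) :
    ∫ x, Real.exp (-(1 / 2 * ‖ξ - l • e x‖ ^ 2)) ∂μ ≤
      C * (l / 4) ^ (-s) * Real.exp (R ^ 2 / 4) * Real.exp (-(1 / (8 * l ^ 2) * ‖ξ - 0‖ ^ 2)) := by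
  have hl0 : 0 < l := by linarith
  rcases isEmpty_or_nonempty X with hX | hX
  · simp only [integral_of_isEmpty]
    positivity
  obtain ⟨x₀, -, hx₀⟩ := isCompact_univ.exists_isMinOn (univ_nonempty (α := X))
    (f := fun x => ‖ξ - l • e x‖) (by fun_prop)
  have hpt (x : X) : Real.exp (-(1 / 2 * ‖ξ - l • e x‖ ^ 2)) ≤
      Real.exp (-((l / 4) ^ 2 * ‖e x₀ - e x‖ ^ 2)) *
        (Real.exp (R ^ 2 / 4) * Real.exp (-(1 / (8 * l ^ 2) * ‖ξ - 0‖ ^ 2))) := by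
    rw [← Real.exp_add, ← Real.exp_add, Real.exp_le_exp, sub_zero]
    have h1 : l * ‖e x₀ - e x‖ ≤ 2 * ‖ξ - l • e x‖ := by
      have h2 : ‖ξ - l • e x₀‖ ≤ ‖ξ - l • e x‖ := hx₀ (mem_univ x)
      have h3 : l * ‖e x₀ - e x‖ = ‖(ξ - l • e x) - (ξ - l • e x₀)‖ := by
        rw [sub_sub_sub_cancel_left, ← smul_sub, norm_smul, Real.norm_of_nonneg hl0.le]
      rw [h3]
      linarith [norm_sub_le (ξ - l • e x) (ξ - l • e x₀)]
    have h2 : ‖ξ‖ ≤ ‖ξ - l • e x‖ + l * R := by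
      have := norm_add_le (ξ - l • e x) (l • e x)
      rw [sub_add_cancel, norm_smul, Real.norm_of_nonneg hl0.le] at this
      linarith [mul_le_mul_of_nonneg_left (hR x) hl0.le]
    set u := ‖ξ - l • e x‖
    have hu : 0 ≤ u := norm_nonneg _
    have h3 : (l / 4) ^ 2 * ‖e x₀ - e x‖ ^ 2 ≤ u ^ 2 / 4 := by
      have := pow_le_pow_left₀ (by positivity) h1 2
      nlinarith
    have h4 : 1 / (8 * l ^ 2) * ‖ξ‖ ^ 2 ≤ u ^ 2 / 4 + R ^ 2 / 4 := by
      have h5 := pow_le_pow_left₀ (norm_nonneg _) h2 2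
      have h6 : u ^ 2 ≤ u ^ 2 * l ^ 2 := le_mul_of_one_le_right (sq_nonneg _) (one_le_pow₀ hl)
      rw [one_div, inv_mul_eq_div, div_le_iff₀ (by positivity)]
      nlinarith [sq_nonneg (u - l * R)]
    linarith
  have hc1 : Continuous fun x => Real.exp (-(1 / 2 * ‖ξ - l • e x‖ ^ 2)) := by fun_prop
  have hc2 : Continuous fun x => Real.exp (-((l / 4) ^ 2 * ‖e x₀ - e x‖ ^ 2)) *
      (Real.exp (R ^ 2 / 4) * Real.exp (-(1 / (8 * l ^ 2) * ‖ξ - 0‖ ^ 2))) := by fun_prop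
  refine (integral_mono (integrable_of_continuous μ hc1) (integrable_of_continuous μ hc2)
    hpt).trans ?_
  rw [integral_mul_const, mul_assoc (C * _)]
  exact mul_le_mul_of_nonneg_right (hF x₀ _ (by positivity)) (by positivity)

theorem integral_integral_mul_le_schur {k : X → X → ℝ}
    (hk : Continuous fun p : X × X => k p.1 p.2) (hs : ∀ x y, k x y = k y x)
    (hk0 : ∀ x y, 0 ≤ k x y) {D : ℝ} (hD : ∀ x, ∫ y, k x y ∂μ ≤ D) {f : X → ℝ}
    (hf : Continuous f) :
    ∫ x, ∫ y, f x * f y * k x y ∂μ ∂μ ≤ D * ∫ x, f x ^ 2 ∂μ := by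
  have hc1 : Continuous fun p : X × X => f p.1 * f p.2 * k p.1 p.2 := by fun_prop
  have hc2 : Continuous fun p : X × X => f p.1 ^ 2 * k p.1 p.2 := by fun_prop
  have hc3 : Continuous fun p : X × X => f p.2 ^ 2 * k p.1 p.2 := by fun_prop
  have e1 : ∫ x, ∫ y, f x ^ 2 * k x y ∂μ ∂μ ≤ D * ∫ x, f x ^ 2 ∂μ := by
    simp only [integral_const_mul]
    rw [mul_comm, ← integral_mul_const]
    have : Continuous fun x => ∫ y, k x y ∂μ := continuous_integral μ hk
    exact integral_mono (integrable_of_continuous μ (by fun_prop))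
      (integrable_of_continuous μ (by fun_prop))
      fun x => mul_le_mul_of_nonneg_left (hD x) (sq_nonneg _)
  have e2 : ∫ x, ∫ y, f y ^ 2 * k x y ∂μ ∂μ = ∫ x, ∫ y, f x ^ 2 * k x y ∂μ ∂μ := by
    rw [integral_swap μ (F := fun x y => f y ^ 2 * k x y) hc3]
    simp only [hs]
  rw [← integral_prod_eq μ (F := fun x y => f x ^ 2 * k x y) hc2] at e1 e2
  rw [← integral_prod_eq μ (F := fun x y => f y ^ 2 * k x y) hc3] at e2
  rw [← integral_prod_eq μ (F := fun x y => f x * f y * k x y) hc1]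
  have := integral_mono (μ := μ.prod μ) ((integrable_of_continuous _ hc1).const_mul 2)
    ((integrable_of_continuous _ hc2).add (integrable_of_continuous _ hc3)) fun p => by
      simp only [Pi.add_apply]
      nlinarith [hk0 p.1 p.2, sq_nonneg (f p.1 - f p.2)]
  rw [integral_const_mul, integral_add' (integrable_of_continuous _ hc2)
    (integrable_of_continuous _ hc3), e2] at this
  linarith

variable [FiniteDimensional ℝ V] [MeasurableSpace V] [BorelSpace V]

theorem integral_cexp_inner_mul_gauss {a : ℝ} (ha : 0 < a) (y : V) :
    ∫ ξ : V, cexp (-(I * ⟪y, ξ⟫_ℝ)) * (Real.exp (-(a * ‖ξ‖ ^ 2)) : ℂ)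
      = (((Real.pi / a) ^ ((Module.finrank ℝ V : ℝ) / 2) *
          Real.exp (-(‖y‖ ^ 2 / (4 * a))) : ℝ) : ℂ) := by
  have := GaussianFourier.integral_cexp_neg_mul_sq_norm_add (V := V) (b := (a : ℂ))
    (by simpa using ha) (-I) y
  convert this using 1
  · congr 1
    funext ξ
    push_cast
    rw [← Complex.exp_add]
    congr 1
    ring
  · push_cast
    rw [ofReal_cpow (by positivity)]
    push_cast
    congr 2
    rw [neg_sq, I_sq]
    ring

theorem integrable_gauss {a : ℝ} (ha : 0 < a) (z : V) :
    Integrable fun ξ : V => Real.exp (-(a * ‖ξ - z‖ ^ 2)) := by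
  have := GaussianFourier.integrable_cexp_neg_mul_sq_norm_add (V := V) (b := (a : ℂ))
    (by simpa using ha) 0 0
  have h2 : Integrable fun ξ : V => Real.exp (-(a * ‖ξ‖ ^ 2)) := by
    refine this.norm.congr (.of_forall fun ξ => ?_)
    simp [Complex.norm_exp, ← ofReal_pow]
  exact h2.comp_sub_right z

theorem integral_cexp_inner_mul_gauss_sub {a : ℝ} (ha : 0 < a) (y z : V) :
    ∫ ξ : V, cexp (-(I * ⟪y, ξ⟫_ℝ)) * (Real.exp (-(a * ‖ξ - z‖ ^ 2)) : ℂ)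
      = cexp (-(I * ⟪y, z⟫_ℝ)) * (((Real.pi / a) ^ ((Module.finrank ℝ V : ℝ) / 2) *
          Real.exp (-(‖y‖ ^ 2 / (4 * a))) : ℝ) : ℂ) := by
  rw [← integral_cexp_inner_mul_gauss ha, ← integral_const_mul, ← integral_sub_right_eq_self
    (fun ξ => cexp (-(I * ⟪y, z⟫_ℝ)) * (cexp (-(I * ⟪y, ξ⟫_ℝ)) *
      (Real.exp (-(a * ‖ξ‖ ^ 2)) : ℂ))) z]
  refine integral_congr_ae (.of_forall fun ξ => ?_)
  simp only
  rw [← mul_assoc, ← Complex.exp_add, inner_sub_right]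
  congr 2
  push_cast
  ring

theorem integral_gauss_sub {a : ℝ} (ha : 0 < a) (z : V) :
    ∫ ξ : V, Real.exp (-(a * ‖ξ - z‖ ^ 2))
      = (Real.pi / a) ^ ((Module.finrank ℝ V : ℝ) / 2) := by
  have := integral_cexp_inner_mul_gauss_sub ha (0 : V) z
  simp only [inner_zero_left, ofReal_zero, mul_zero, neg_zero, Complex.exp_zero, one_mul,
    norm_zero] at this
  rw [integral_complex_ofReal] at this
  have := ofReal_injective this
  simpa using this

end Extension

section Extension

open Filter Topology Complex
open scoped InnerProductSpace ComplexConjugate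

variable {V : Type*} [NormedAddCommGroup V] [InnerProductSpace ℝ V]
  {X : Type*} [MeasurableSpace X] (μ : Measure X) {e : X → V} {H : X → ℂ}

/-- The Fourier transform of the measure `H μ`, transported to `V` by `e`. -/
noncomputable def extension (e : X → V) (H : X → ℂ) (ξ : V) : ℂ :=
  ∫ y, cexp (-(I * ⟪e y, ξ⟫_ℝ)) * H y ∂μ

theorem norm_cexp_inner (y ξ : V) : ‖cexp (-(I * ⟪y, ξ⟫_ℝ))‖ = 1 := by
  rw [mul_comm, ← neg_mul, ← ofReal_neg, norm_exp_ofReal_mul_I]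

theorem norm_extension_le (ξ : V) : ‖extension μ e H ξ‖ ≤ ∫ y, ‖H y‖ ∂μ := by
  refine (norm_integral_le_integral_norm _).trans (le_of_eq ?_)
  simp only [norm_mul, norm_cexp_inner, one_mul]

variable [MetricSpace X] [CompactSpace X] [BorelSpace X] [IsFiniteMeasure μ]
  [FiniteDimensional ℝ V]

theorem continuous_extension (he : Continuous e) (hH : Continuous H) :
    Continuous (extension μ e H) := by
  have := continuous_parametric_integral_of_continuous (μ := μ)
    (f := fun ξ y => cexp (-(I * ⟪e y, ξ⟫_ℝ)) * H y) (by fun_prop) isCompact_univ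
  simp only [Measure.restrict_univ] at this
  exact this

variable [MeasurableSpace V] [BorelSpace V]

theorem integral_gauss_mul_sq_norm_extension_le (he : Continuous e) (hH : Continuous H) {a : ℝ}
    (ha : 0 < a) {D : ℝ} (hD : ∀ x, ∫ y, Real.exp (-(‖e x - e y‖ ^ 2 / (4 * a))) ∂μ ≤ D) :
    ∫ ξ, Real.exp (-(a * ‖ξ - 0‖ ^ 2)) * ‖extension μ e H ξ‖ ^ 2 ≤
      (Real.pi / a) ^ ((Module.finrank ℝ V : ℝ) / 2) * (D * ∫ x, ‖H x‖ ^ 2 ∂μ) := by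
  set P := (Real.pi / a) ^ ((Module.finrank ℝ V : ℝ) / 2) with hP
  have hP0 : 0 ≤ P := by positivity
  have hcH : Continuous fun p : X × X => H p.1 * conj (H p.2) := by fun_prop
  have hsq (ξ : V) : ((‖extension μ e H ξ‖ ^ 2 : ℝ) : ℂ)
      = ∫ p, cexp (-(I * ⟪e p.1 - e p.2, ξ⟫_ℝ)) * (H p.1 * conj (H p.2)) ∂μ.prod μ := by
    rw [ofReal_pow, ← mul_conj', extension, ← integral_conj, ← integral_prod_mul]
    refine integral_congr_ae (.of_forall fun p => ?_)
    simp only [map_mul, ← exp_conj, map_neg, conj_I, conj_ofReal]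
    rw [mul_mul_mul_comm, ← Complex.exp_add, inner_sub_left]
    congr 2
    push_cast
    ring
  have hint : Integrable (fun z : (X × X) × V => (Real.exp (-(a * ‖z.2 - 0‖ ^ 2)) : ℂ) *
      (cexp (-(I * ⟪e z.1.1 - e z.1.2, z.2⟫_ℝ)) * (H z.1.1 * conj (H z.1.2))))
      ((μ.prod μ).prod volume) := by
    have h1 := (integrable_of_continuous (μ.prod μ) hcH).norm.mul_prod
      (integrable_gauss ha (0 : V))
    refine h1.mono' (Continuous.aestronglyMeasurable (by fun_prop)) (.of_forall fun z => ?_)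
    rw [norm_mul, norm_mul, norm_cexp_inner, one_mul, norm_real, Real.norm_of_nonneg
      (Real.exp_pos _).le, mul_comm]
  have key : ((∫ ξ, Real.exp (-(a * ‖ξ - 0‖ ^ 2)) * ‖extension μ e H ξ‖ ^ 2 : ℝ) : ℂ)
      = ∫ p, (P * Real.exp (-(‖e p.1 - e p.2‖ ^ 2 / (4 * a))) : ℝ) * (H p.1 * conj (H p.2))
        ∂μ.prod μ := by
    rw [← integral_complex_ofReal]
    simp only [ofReal_mul, hsq, ← integral_const_mul]
    rw [← integral_integral_swap hint]
    refine integral_congr_ae (.of_forall fun p => ?_)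
    simp only
    rw [← ofReal_mul, ← integral_cexp_inner_mul_gauss ha, ← integral_mul_const]
    refine integral_congr_ae (.of_forall fun ξ => ?_)
    simp only [sub_zero]
    ring
  have hk : Continuous fun p : X × X => Real.exp (-(‖e p.1 - e p.2‖ ^ 2 / (4 * a))) := by fun_prop
  have hschur := integral_integral_mul_le_schur μ
    (k := fun x y => Real.exp (-(‖e x - e y‖ ^ 2 / (4 * a)))) hk
    (fun x y => by rw [norm_sub_rev]) (fun x y => (Real.exp_pos _).le) hD (f := fun x => ‖H x‖)
    (by fun_prop)
  rw [← integral_prod_eq μ (F := fun x y => ‖H x‖ * ‖H y‖ *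
    Real.exp (-(‖e x - e y‖ ^ 2 / (4 * a)))) (by fun_prop)] at hschur
  have h0 : 0 ≤ ∫ ξ, Real.exp (-(a * ‖ξ - 0‖ ^ 2)) * ‖extension μ e H ξ‖ ^ 2 :=
    integral_nonneg fun ξ => by positivity
  rw [← Real.norm_of_nonneg h0, ← norm_real, key]
  refine (norm_integral_le_integral_norm _).trans ?_
  refine le_trans (le_of_eq ?_) (mul_le_mul_of_nonneg_left hschur hP0)
  rw [← integral_const_mul]
  refine integral_congr_ae (.of_forall fun p => ?_)
  simp only [norm_mul, norm_real, RCLike.norm_conj, Real.norm_of_nonneg hP0,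
    Real.norm_of_nonneg (Real.exp_pos _).le]
  ring

theorem integral_gauss_mul_extension (he : Continuous e) (hH : Continuous H) (z : V) :
    ∫ ξ, (Real.exp (-(1 / 2 * ‖ξ - z‖ ^ 2)) : ℂ) * extension μ e H ξ
      = ((Real.pi / (1 / 2)) ^ ((Module.finrank ℝ V : ℝ) / 2) : ℝ) *
        ∫ y, cexp (-(I * ⟪e y, z⟫_ℝ)) * (Real.exp (-(‖e y‖ ^ 2 / (4 * (1 / 2)))) * H y) ∂μ := by
  have hint : Integrable (fun w : X × V => (Real.exp (-(1 / 2 * ‖w.2 - z‖ ^ 2)) : ℂ) *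
      (cexp (-(I * ⟪e w.1, w.2⟫_ℝ)) * H w.1)) (μ.prod volume) := by
    have h1 := (integrable_of_continuous μ hH).norm.mul_prod
      (integrable_gauss (show (0 : ℝ) < 1 / 2 by norm_num) z)
    refine h1.mono' (Continuous.aestronglyMeasurable (by fun_prop)) (.of_forall fun w => ?_)
    rw [norm_mul, norm_mul, norm_cexp_inner, one_mul, norm_real, Real.norm_of_nonneg
      (Real.exp_pos _).le, mul_comm]
  simp only [extension, ← integral_const_mul]
  rw [← integral_integral_swap hint]
  refine integral_congr_ae (.of_forall fun y => ?_)
  have := integral_cexp_inner_mul_gauss_sub (show (0 : ℝ) < 1 / 2 by norm_num) (e y) z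
  simp only
  calc _ = (∫ ξ : V, cexp (-(I * ⟪e y, ξ⟫_ℝ)) * (Real.exp (-(1 / 2 * ‖ξ - z‖ ^ 2)) : ℂ)) * H y := by
        rw [← integral_mul_const]
        exact integral_congr_ae (.of_forall fun ξ => by simp only; ring)
    _ = _ := by rw [this, ofReal_mul]; ring

/-- The `L²(μ)` bound for the Fourier transform at scale `l`. -/
theorem exists_integral_sq_norm_extension_le (he : Continuous e) {C s : ℝ} (hC : 0 ≤ C)
    (hF : ∀ x, ∀ l > 0, ∫ y, Real.exp (-(l ^ 2 * ‖e x - e y‖ ^ 2)) ∂μ ≤ C * l ^ (-s)) :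
    ∃ K, 0 ≤ K ∧ ∀ l ≥ 1, ∀ A : X → ℂ, Continuous A →
      ∫ x, ‖extension μ e A (l • e x)‖ ^ 2 ∂μ ≤
        K * l ^ ((Module.finrank ℝ V : ℝ) - 2 * s) * ∫ x, ‖A x‖ ^ 2 ∂μ := by
  obtain ⟨R, hR'⟩ := (isCompact_range he).isBounded.exists_norm_le
  have hR (x : X) : ‖e x‖ ≤ R := hR' _ ⟨x, rfl⟩
  set n : ℝ := ((Module.finrank ℝ V : ℕ) : ℝ) with hn
  set P : ℝ := (Real.pi / (1 / 2)) ^ (n / 2) with hP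
  have hP0 : 0 < P := by positivity
  refine ⟨P⁻¹ * (C * 4⁻¹ ^ (-s) * Real.exp (R ^ 2 / 4)) * (8 * Real.pi) ^ (n / 2) *
    (C * √2 ^ (-s)) * Real.exp (R ^ 2), by positivity, fun l hl A hA => ?_⟩
  have hl0 : 0 < l := by linarith
  set H : X → ℂ := fun y => Real.exp (‖e y‖ ^ 2 / (4 * (1 / 2))) * A y with hHdef
  have hH : Continuous H := by fun_prop
  set g : V → ℝ := fun ξ => ‖extension μ e H ξ‖ ^ 2 with hg
  have hgc : Continuous g := ((continuous_extension μ he hH).norm.pow 2)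
  have hg0 (ξ) : 0 ≤ g ξ := by positivity
  have hgB (ξ : V) : ‖g ξ‖ ≤ (∫ y, ‖H y‖ ∂μ) ^ 2 := by
    rw [Real.norm_of_nonneg (hg0 ξ)]
    exact pow_le_pow_left₀ (norm_nonneg _) (norm_extension_le μ ξ) 2
  have hgi {a : ℝ} (ha : 0 < a) (z : V) :
      Integrable fun ξ => Real.exp (-(a * ‖ξ - z‖ ^ 2)) * g ξ :=
    (integrable_gauss ha z).mul_bdd (c := (∫ y, ‖H y‖ ∂μ) ^ 2) hgc.aestronglyMeasurable
      (.of_forall hgB)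
  have half : (0 : ℝ) < 1 / 2 := by norm_num
  have hpt (x : X) : ‖extension μ e A (l • e x)‖ ^ 2 ≤
      P⁻¹ * ∫ ξ, Real.exp (-(1 / 2 * ‖ξ - l • e x‖ ^ 2)) * g ξ := by
    have h1 := integral_gauss_mul_extension μ he hH (l • e x)
    have h2 : ∫ y, cexp (-(I * ⟪e y, l • e x⟫_ℝ)) *
        (Real.exp (-(‖e y‖ ^ 2 / (4 * (1 / 2)))) * H y) ∂μ = extension μ e A (l • e x) := by
      refine integral_congr_ae (.of_forall fun y => ?_)
      simp only [hHdef]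
      rw [← mul_assoc (Complex.ofReal _), ← ofReal_mul, ← Real.exp_add, neg_add_cancel,
        Real.exp_zero, ofReal_one, one_mul]
    rw [h2] at h1
    have h3 := sq_norm_integral_smul_le volume
      (w := fun ξ => Real.exp (-(1 / 2 * ‖ξ - l • e x‖ ^ 2))) (fun _ => (Real.exp_pos _).le)
      (integrable_gauss half _) (G := extension μ e H)
      ((integrable_gauss half _).mul_bdd (c := ∫ y, ‖H y‖ ∂μ)
        (continuous_extension μ he hH).norm.aestronglyMeasurable (.of_forall fun ξ => by
          rw [norm_norm]; exact norm_extension_le μ ξ)) (hgi half _)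
    rw [h1, integral_gauss_sub half, norm_mul, norm_real, ← hn, ← hP, Real.norm_of_nonneg hP0.le,
      mul_pow] at h3
    rw [inv_mul_eq_div, le_div_iff₀ hP0]
    refine le_of_mul_le_mul_left ?_ hP0
    calc _ = P ^ 2 * ‖extension μ e A (l • e x)‖ ^ 2 := by ring
      _ ≤ _ := h3
  have hint : Integrable (fun z : X × V => Real.exp (-(1 / 2 * ‖z.2 - l • e z.1‖ ^ 2)) * g z.2)
      (μ.prod volume) := by
    have h1 := (((integrable_gauss (show (0 : ℝ) < 1 / 4 by norm_num) (0 : V)).const_mul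
      (Real.exp (l ^ 2 * R ^ 2 / 2))).mul_const ((∫ y, ‖H y‖ ∂μ) ^ 2)).comp_snd μ
    refine h1.mono' (Continuous.aestronglyMeasurable (by fun_prop)) (.of_forall fun z => ?_)
    rw [norm_mul, Real.norm_of_nonneg (Real.exp_pos _).le]
    refine mul_le_mul ?_ (hgB _) (norm_nonneg _) (by positivity)
    rw [← Real.exp_add, Real.exp_le_exp, sub_zero]
    have h2 : ‖z.2‖ ≤ ‖z.2 - l • e z.1‖ + l * R := by
      have := norm_add_le (z.2 - l • e z.1) (l • e z.1)
      rw [sub_add_cancel, norm_smul, Real.norm_of_nonneg hl0.le] at this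
      linarith [mul_le_mul_of_nonneg_left (hR z.1) hl0.le]
    have h3 := pow_le_pow_left₀ (norm_nonneg _) h2 2
    nlinarith [sq_nonneg (‖z.2 - l • e z.1‖ - l * R)]
  have hW := integral_gauss_le μ he hF hR hl hC
  set W := C * (l / 4) ^ (-s) * Real.exp (R ^ 2 / 4) with hWdef
  set a := 1 / (8 * l ^ 2) with ha
  have ha0 : 0 < a := by positivity
  have step1 : ∫ x, ‖extension μ e A (l • e x)‖ ^ 2 ∂μ ≤
      P⁻¹ * (W * ∫ ξ, Real.exp (-(a * ‖ξ - 0‖ ^ 2)) * g ξ) := by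
    have hc : Continuous fun x => ‖extension μ e A (l • e x)‖ ^ 2 :=
      (((continuous_extension μ he hA).comp (he.const_smul l)).norm.pow 2)
    refine (integral_mono (integrable_of_continuous μ hc)
      (hint.integral_prod_left.const_mul P⁻¹) hpt).trans ?_
    rw [integral_const_mul]
    refine mul_le_mul_of_nonneg_left ?_ (by positivity)
    rw [integral_integral_swap hint, ← integral_const_mul]
    refine integral_mono hint.integral_prod_right ((hgi ha0 0).const_mul W) fun ξ => ?_
    simp only [integral_mul_const, ← mul_assoc]
    exact mul_le_mul_of_nonneg_right (hW ξ) (hg0 ξ)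
  have step2 := integral_gauss_mul_sq_norm_extension_le μ he hH ha0 (D := C * (√2 * l) ^ (-s))
    fun x => by
      convert hF x (√2 * l) (by positivity) using 5 with y
      rw [ha, mul_pow, Real.sq_sqrt (by norm_num)]
      field_simp
      ring
  have step3 : ∫ x, ‖H x‖ ^ 2 ∂μ ≤ Real.exp (R ^ 2) * ∫ x, ‖A x‖ ^ 2 ∂μ := by
    rw [← integral_const_mul]
    refine integral_mono (integrable_of_continuous μ (by fun_prop))
      (integrable_of_continuous μ (by fun_prop)) fun x => ?_
    simp only [hHdef, norm_mul, mul_pow, norm_real]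
    refine mul_le_mul_of_nonneg_right ?_ (sq_nonneg _)
    rw [Real.norm_of_nonneg (Real.exp_pos _).le, ← Real.exp_nat_mul, Real.exp_le_exp]
    have := pow_le_pow_left₀ (norm_nonneg _) (hR x) 2
    push_cast
    linarith
  have hW0 : 0 ≤ W := by positivity
  calc _ ≤ P⁻¹ * (W * ((Real.pi / a) ^ (n / 2) * (C * (√2 * l) ^ (-s) *
        (Real.exp (R ^ 2) * ∫ x, ‖A x‖ ^ 2 ∂μ)))) := by
        refine step1.trans ?_
        refine mul_le_mul_of_nonneg_left ?_ (by positivity)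
        refine mul_le_mul_of_nonneg_left ?_ hW0
        refine step2.trans ?_
        refine mul_le_mul_of_nonneg_left ?_ (by positivity)
        exact mul_le_mul_of_nonneg_left step3 (by positivity)
    _ = _ := by
        have e1 : Real.pi / a = (8 * Real.pi) * l ^ 2 := by rw [ha]; field_simp
        rw [e1, hWdef, Real.mul_rpow (by positivity) (by positivity),
          Real.mul_rpow (by positivity) hl0.le, div_eq_mul_inv, Real.mul_rpow hl0.le (by norm_num),
          ← Real.rpow_natCast l 2, ← Real.rpow_mul hl0.le]
        have e2 : l ^ (n - 2 * s) = l ^ (-s) * l ^ (((2 : ℕ) : ℝ) * (n / 2)) * l ^ (-s) := by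
          rw [← Real.rpow_add hl0, ← Real.rpow_add hl0]
          congr 1
          push_cast
          ring
        rw [e2]
        ring

end Extension

section Cosine

open Complex
open scoped InnerProductSpace

variable {X : Type*} [MetricSpace X] [CompactSpace X] [MeasurableSpace X] [BorelSpace X]
  (μ : Measure X) [IsProbabilityMeasure μ]

theorem integral_abs_le_l2norm {f : X → ℝ} (hf : Continuous f) : ∫ x, |f x| ∂μ ≤ l2norm μ f := by
  refine (abs_le_of_sq_le_sq' ?_ (l2norm_nonneg _ _)).2
  rw [l2norm_sq]
  simpa using sq_integral_le μ hf.abs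

theorem opBound_cos (q : X → X → ℝ) :
    OpBound μ (fun x y => Real.cos (q x y)) 1 := by
  intro f g hf hg
  rw [one_mul]
  have h1 (x : X) : |∫ y, Real.cos (q x y) * f y ∂μ| ≤ l2norm μ f := by
    rw [← Real.norm_eq_abs]
    refine (norm_integral_le_of_norm_le (integrable_of_continuous μ hf.abs)
      (.of_forall fun y => ?_)).trans (integral_abs_le_l2norm μ hf)
    rw [norm_mul]
    exact mul_le_of_le_one_left (abs_nonneg _) (Real.abs_cos_le_one _)
  calc _ ≤ ∫ x, l2norm μ f * |g x| ∂μ := by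
        rw [← Real.norm_eq_abs]
        refine norm_integral_le_of_norm_le
          ((integrable_of_continuous μ hg.abs).const_mul _) (.of_forall fun x => ?_)
        rw [norm_mul]
        exact mul_le_mul_of_nonneg_right (h1 x) (abs_nonneg _)
    _ ≤ _ := by
        rw [integral_const_mul]
        exact mul_le_mul_of_nonneg_left (integral_abs_le_l2norm μ hg) (l2norm_nonneg _ _)

variable {V : Type*} [NormedAddCommGroup V] [InnerProductSpace ℝ V] {e : X → V}

theorem abs_integral_cos_le (he : Continuous e) {f : X → ℝ} (hf : Continuous f) (v τ : ℝ) (x : X) :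
    |∫ y, Real.cos (τ * (‖e x - e y‖ ^ 2 - v)) * f y ∂μ| ≤
      ‖extension μ e (fun y => cexp ((τ * ‖e y‖ ^ 2 : ℝ) * I) * f y) ((2 * τ) • e x)‖ := by
  have h : ∫ y, Real.cos (τ * (‖e x - e y‖ ^ 2 - v)) * f y ∂μ
      = (cexp ((τ * (‖e x‖ ^ 2 - v) : ℝ) * I) *
        extension μ e (fun y => cexp ((τ * ‖e y‖ ^ 2 : ℝ) * I) * f y) ((2 * τ) • e x)).re := by
    rw [extension, ← integral_const_mul]
    have hc : Continuous fun y => cexp ((τ * (‖e x‖ ^ 2 - v) : ℝ) * I) *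
        (cexp (-(I * ⟪e y, (2 * τ) • e x⟫_ℝ)) * (cexp ((τ * ‖e y‖ ^ 2 : ℝ) * I) * f y)) := by
      fun_prop
    refine Eq.trans ?_ (integral_re (integrable_of_continuous μ hc))
    refine integral_congr_ae (.of_forall fun y => ?_)
    simp only
    have e1 : cexp ((τ * (‖e x‖ ^ 2 - v) : ℝ) * I) * (cexp (-(I * ⟪e y, (2 * τ) • e x⟫_ℝ)) *
        (cexp ((τ * ‖e y‖ ^ 2 : ℝ) * I) * f y))
        = cexp ((τ * (‖e x - e y‖ ^ 2 - v) : ℝ) * I) * f y := by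
      rw [← mul_assoc, ← mul_assoc, ← Complex.exp_add, ← Complex.exp_add, norm_sub_sq_real,
        inner_smul_right, real_inner_comm]
      congr 2
      push_cast
      ring
    rw [e1]
    change _ = Complex.re _
    rw [re_mul_ofReal, exp_ofReal_mul_I_re]
  rw [h]
  refine (abs_re_le_norm _).trans ?_
  rw [norm_mul, norm_exp_ofReal_mul_I, one_mul]

variable [FiniteDimensional ℝ V] [MeasurableSpace V] [BorelSpace V]

theorem exists_opBound_cos (he : Continuous e) {C s : ℝ} (hC : 0 ≤ C)
    (hF : ∀ x, ∀ l > 0, ∫ y, Real.exp (-(l ^ 2 * ‖e x - e y‖ ^ 2)) ∂μ ≤ C * l ^ (-s)) :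
    ∃ K, 0 ≤ K ∧ ∀ v, ∀ τ > 1, OpBound μ (fun x y => Real.cos (τ * (‖e x - e y‖ ^ 2 - v)))
      (K * τ ^ ((Module.finrank ℝ V : ℝ) / 2 - s)) := by
  obtain ⟨K, hK, H⟩ := exists_integral_sq_norm_extension_le μ he hC hF
  set n : ℝ := ((Module.finrank ℝ V : ℕ) : ℝ)
  refine ⟨√K * 2 ^ (n / 2 - s), by positivity, fun v τ hτ f g hf hg => ?_⟩
  have hA : Continuous fun y => cexp ((τ * ‖e y‖ ^ 2 : ℝ) * I) * (f y : ℂ) := by fun_prop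
  have hR : Continuous fun p : X × X => Real.cos (τ * (‖e p.1 - e p.2‖ ^ 2 - v)) := by fun_prop
  have hT := continuous_apply_kernel μ
    (R := fun x y => Real.cos (τ * (‖e x - e y‖ ^ 2 - v))) hR hf
  refine (abs_integral_mul_le_l2norm μ hT hg).trans ?_
  refine mul_le_mul_of_nonneg_right ?_ (l2norm_nonneg _ _)
  refine (abs_le_of_sq_le_sq' ?_ (mul_nonneg (by positivity) (l2norm_nonneg _ _))).2
  rw [l2norm_sq, mul_pow, l2norm_sq]
  have h1 := H (2 * τ) (by linarith) _ hA
  simp only [norm_mul, norm_exp_ofReal_mul_I, one_mul, norm_real, Real.norm_eq_abs, sq_abs] at h1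
  have hc : Continuous fun x => extension μ e
      (fun y => cexp ((τ * ‖e y‖ ^ 2 : ℝ) * I) * (f y : ℂ)) ((2 * τ) • e x) :=
    (continuous_extension μ he hA).comp (he.const_smul _)
  refine ((integral_mono (integrable_of_continuous μ (hT.pow 2))
    (integrable_of_continuous μ (hc.norm.pow 2)) fun x => ?_).trans h1).trans (le_of_eq ?_)
  · simp only [Pi.pow_apply]
    rw [← sq_abs]
    exact pow_le_pow_left₀ (abs_nonneg _) (abs_integral_cos_le μ he hf v τ x) 2
  · congr 1
    rw [mul_assoc, ← Real.mul_rpow (by norm_num) (by linarith), mul_pow, Real.sq_sqrt hK,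
      ← Real.rpow_natCast, ← Real.rpow_mul (by linarith)]
    congr 2
    push_cast
    ring

end Cosine

section Equilibrium

open Filter Topology

variable {X : Type*} [MetricSpace X] [CompactSpace X] [MeasurableSpace X] [BorelSpace X]

/-- On a nonempty compact metric space, some probability measure minimises the energy of a given
continuous symmetric kernel; its potential is everywhere at least the energy. -/
theorem exists_energy_le_potential [Nonempty X] {k : X → X → ℝ}
    (hk : Continuous fun p : X × X => k p.1 p.2) (hs : ∀ x y, k x y = k y x) :
    ∃ μ : ProbabilityMeasure X, ∀ y, ∫ x, ∫ z, k x z ∂μ ∂μ ≤ ∫ x, k y x ∂μ := by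
  have hcont : Continuous fun μ : ProbabilityMeasure X =>
      ∫ p, k p.1 p.2 ∂((μ.prod μ : ProbabilityMeasure (X × X)) : Measure (X × X)) :=
    (ProbabilityMeasure.continuous_integral_boundedContinuousFunction
      (BoundedContinuousFunction.mkOfCompact ⟨_, hk⟩)).comp
      (ProbabilityMeasure.continuous_prod.comp (continuous_id.prodMk continuous_id))
  have : Nonempty (ProbabilityMeasure X) :=
    ⟨⟨Measure.dirac (Classical.arbitrary X), inferInstance⟩⟩
  obtain ⟨μ, -, hμ⟩ := isCompact_univ.exists_isMinOn univ_nonempty hcont.continuousOn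
  refine ⟨μ, fun y => ?_⟩
  have henergy (ν : ProbabilityMeasure X) :
      ∫ p, k p.1 p.2 ∂((ν.prod ν : ProbabilityMeasure (X × X)) : Measure (X × X))
        = ∫ x, ∫ z, k x z ∂ν ∂ν := by
    rw [ProbabilityMeasure.toMeasure_prod]
    exact integral_prod _ (integrable_of_continuous _ hk)
  set I := ∫ x, ∫ z, k x z ∂μ ∂μ
  set U := ∫ x, k y x ∂μ
  have hcol (x : X) : Continuous (k x) := hk.comp (continuous_const.prodMk continuous_id)
  have hvar (t : ℝ) (ht0 : 0 < t) (ht1 : t < 1) : (2 - t) * I ≤ 2 * (1 - t) * U + t * k y y := by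
    let ν : Measure X := ENNReal.ofReal (1 - t) • (μ : Measure X) + ENNReal.ofReal t • .dirac y
    have : IsProbabilityMeasure ν := ⟨by
      simp only [ν, Measure.add_apply, Measure.smul_apply, measure_univ, smul_eq_mul, mul_one]
      rw [← ENNReal.ofReal_add (by linarith) ht0.le]
      simp⟩
    have hint {f : X → ℝ} (hf : Continuous f) : ∫ x, f x ∂ν = (1 - t) * ∫ x, f x ∂μ + t * f y := by
      rw [integral_add_measure, integral_smul_measure, integral_smul_measure, integral_dirac,
        ENNReal.toReal_ofReal (by linarith), ENNReal.toReal_ofReal ht0.le, smul_eq_mul,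
        smul_eq_mul]
      · exact (integrable_of_continuous _ hf).smul_measure ENNReal.ofReal_ne_top
      · exact (integrable_of_continuous _ hf).smul_measure ENNReal.ofReal_ne_top
    have hmin : I ≤ ∫ x, ∫ z, k x z ∂ν ∂ν := by
      have h := isMinOn_iff.1 hμ (⟨ν, inferInstance⟩ : ProbabilityMeasure X) (mem_univ _)
      exact (henergy μ).symm.trans_le (h.trans_eq (henergy _))
    have hpot : Continuous fun x => ∫ z, k x z ∂μ := continuous_integral μ (F := k) hk
    have hkx : Continuous fun x => k x y := hk.comp (continuous_id.prodMk continuous_const)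
    have h1 : ∫ x, ∫ z, k x z ∂ν ∂ν
        = (1 - t) * ((1 - t) * I + t * U) + t * ((1 - t) * U + t * k y y) := by
      simp_rw [fun x => hint (hcol x)]
      rw [hint (f := fun x => (1 - t) * ∫ z, k x z ∂μ + t * k x y)
        ((hpot.const_mul _).add (hkx.const_mul _)), integral_add
        ((integrable_of_continuous _ hpot).const_mul _)
        ((integrable_of_continuous _ hkx).const_mul _), integral_const_mul, integral_const_mul]
      simp_rw [fun x => hs x y]
      rfl
    rw [h1] at hmin
    refine le_of_mul_le_mul_left ?_ ht0
    nlinarith [hmin]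
  have hlim : Tendsto (fun t : ℝ => 2 * (1 - t) * U + t * k y y - (2 - t) * I) (𝓝[>] 0)
      (𝓝 (2 * (1 - 0) * U + 0 * k y y - (2 - 0) * I)) :=
    (Continuous.tendsto (by fun_prop) _).mono_left nhdsWithin_le_nhds
  have := ge_of_tendsto hlim (b := 0) (by
    filter_upwards [Ioo_mem_nhdsGT one_pos] with t ht
    linarith [hvar t ht.1 ht.2])
  linarith

/-- For a kernel which at most grows by a factor `A` when the distance is halved, the potential of
an equilibrium measure is at most `A` times its energy. -/
theorem exists_potential_le [Nonempty X] {κ : ℝ → ℝ} (hκ : ContinuousOn κ (Ici 0))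
    (hanti : ∀ r r', 0 ≤ r → r ≤ r' → κ r' ≤ κ r) {A : ℝ} (hA0 : 0 ≤ A)
    (hA : ∀ r, 0 ≤ r → κ r ≤ A * κ (2 * r)) :
    ∃ μ : Measure X, IsProbabilityMeasure μ ∧ ∃ I : ℝ, (∀ y, I ≤ ∫ x, κ (dist y x) ∂μ) ∧
      ∀ y, ∫ x, κ (dist y x) ∂μ ≤ A * I := by
  have hk : Continuous fun p : X × X => κ (dist p.1 p.2) :=
    hκ.comp_continuous continuous_dist fun p => dist_nonneg
  obtain ⟨⟨μ, hprob⟩, hμ⟩ := exists_energy_le_potential (k := fun x y => κ (dist x y)) hk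
    fun x y => by rw [dist_comm]
  change ∀ y, ∫ x, ∫ z, κ (dist x z) ∂μ ∂μ ≤ ∫ x, κ (dist y x) ∂μ at hμ
  set I := ∫ x, ∫ z, κ (dist x z) ∂μ ∂μ with hI
  refine ⟨μ, hprob, I, hμ, fun y => ?_⟩
  have hU : Continuous fun x => ∫ z, κ (dist x z) ∂μ :=
    continuous_integral μ (F := fun x z => κ (dist x z)) hk
  have hzero : ∀ᵐ x ∂μ, ∫ z, κ (dist x z) ∂μ = I := by
    have h := (integral_eq_zero_iff_of_nonneg (μ := μ)
      (f := fun x => (∫ z, κ (dist x z) ∂μ) - I) (fun x => sub_nonneg.2 (hμ x))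
      (integrable_of_continuous _ (hU.sub continuous_const))).1 (by
        rw [integral_sub (integrable_of_continuous _ hU) (integrable_const _)]
        simp [hI])
    filter_upwards [h] with x hx
    exact sub_eq_zero.1 hx
  have hclosed : IsClosed {x | ∫ z, κ (dist x z) ∂μ = I} := isClosed_eq hU continuous_const
  have hne : {x | ∫ z, κ (dist x z) ∂μ = I}.Nonempty := hzero.exists
  obtain ⟨x₀, hx₀, hmin⟩ := hclosed.isCompact.exists_isMinOn hne
    (f := fun x => dist y x) (by fun_prop)
  have hx₀' : ∫ z, κ (dist x₀ z) ∂μ = I := hx₀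
  have hcol (x : X) : Continuous fun z => κ (dist x z) :=
    hk.comp (continuous_const.prodMk continuous_id)
  rw [← hx₀', ← integral_const_mul]
  refine integral_mono_ae (integrable_of_continuous _ (hcol y))
    ((integrable_of_continuous _ (hcol x₀)).const_mul _) ?_
  filter_upwards [hzero] with z hz
  have hd : dist x₀ z ≤ 2 * dist y z := by
    have := isMinOn_iff.1 hmin z hz
    linarith [dist_triangle_left x₀ z y]
  exact (hA (dist y z) dist_nonneg).trans
    (mul_le_mul_of_nonneg_left (hanti _ _ dist_nonneg hd) hA0)

end Equilibrium

section Riesz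

open Filter Topology

/-- The Riesz kernel `r ↦ r ^ (-s)`, truncated at distance `ε`. -/
noncomputable def truncRiesz (s ε r : ℝ) : ℝ := (max r ε) ^ (-s)

variable {s ε : ℝ}

theorem truncRiesz_nonneg (hε : 0 < ε) (r : ℝ) : 0 ≤ truncRiesz s ε r :=
  Real.rpow_nonneg (hε.le.trans (le_max_right _ _)) _

theorem continuous_truncRiesz (hε : 0 < ε) : Continuous (truncRiesz s ε) :=
  (continuous_id.max continuous_const).rpow_const
    fun _ => .inl (hε.trans_le (le_max_right _ _)).ne'

theorem truncRiesz_anti (hs : 0 ≤ s) (hε : 0 < ε) {r r' : ℝ} (h : r ≤ r') :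
    truncRiesz s ε r' ≤ truncRiesz s ε r :=
  Real.rpow_le_rpow_of_nonpos (hε.trans_le (le_max_right _ _)) (max_le_max_right _ h) (by linarith)

theorem truncRiesz_le_two_mul (hs : 0 ≤ s) (hε : 0 < ε) {r : ℝ} :
    truncRiesz s ε r ≤ 2 ^ s * truncRiesz s ε (2 * r) := by
  have hpos : 0 < max r ε := hε.trans_le (le_max_right _ _)
  have h : (2 * max r ε) ^ (-s) ≤ truncRiesz s ε (2 * r) :=
    Real.rpow_le_rpow_of_nonpos (hε.trans_le (le_max_right _ _))
      (max_le (by linarith [le_max_left r ε]) (by linarith [le_max_right r ε])) (by linarith)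
  rw [Real.mul_rpow two_pos.le hpos.le, Real.rpow_neg two_pos.le] at h
  rw [← inv_mul_le_iff₀ (by positivity)]
  exact h

/-- A Gaussian at scale `1 / l` is dominated by the truncated Riesz kernel. -/
theorem exists_exp_neg_le_truncRiesz (hs : 0 ≤ s) : ∃ C, 0 ≤ C ∧ ∀ l > 0, ∀ ε > 0, l * ε ≤ 1 →
    ∀ r ≥ 0, Real.exp (-(l ^ 2 * r ^ 2)) ≤ C * l ^ (-s) * truncRiesz s ε r := by
  refine ⟨⌈s⌉₊.factorial * Real.exp 1, by positivity, fun l hl ε hε hlε r hr => ?_⟩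
  have hpos : 0 < max r ε := hε.trans_le (le_max_right _ _)
  have hle : l * max r ε ≤ 1 + l ^ 2 * r ^ 2 := by
    rcases max_cases r ε with ⟨h, -⟩ | ⟨h, -⟩ <;> rw [h]
    · nlinarith [sq_nonneg (l * r - 1), sq_nonneg (l * r)]
    · nlinarith [sq_nonneg (l * r)]
  have h1 : (l * max r ε) ^ s ≤ (1 + l ^ 2 * r ^ 2) ^ ⌈s⌉₊ := by
    rw [← Real.rpow_natCast]
    exact (Real.rpow_le_rpow (by positivity) hle hs).trans
      (Real.rpow_le_rpow_of_exponent_le (by nlinarith [sq_nonneg (l * r)]) (Nat.le_ceil s))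
  have h2 := Real.pow_div_factorial_le_exp (1 + l ^ 2 * r ^ 2) (by positivity) ⌈s⌉₊
  rw [div_le_iff₀ (by positivity), Real.exp_add] at h2
  rw [Real.exp_neg, mul_assoc, truncRiesz, ← Real.mul_rpow hl.le hpos.le,
    Real.rpow_neg (by positivity), ← div_eq_mul_inv, le_div_iff₀ (by positivity),
    inv_mul_le_iff₀ (by positivity)]
  linarith

end Riesz

section Frostman

open Filter Topology Function

variable {X : Type*} [MetricSpace X] [MeasurableSpace X] [BorelSpace X]

theorem exists_countable_cover_of_le_measure (μ : Measure X) [IsProbabilityMeasure μ] {η p : ℝ}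
    (hη : 0 < η) (hp : 0 < p) {r : X → ℝ} (hr0 : ∀ y, 0 < r y)
    (hr : ∀ y, η * r y ^ p ≤ μ.real (Metric.closedBall y (r y))) :
    ∃ u : Set X, u.Countable ∧ univ ⊆ ⋃ b : u, Metric.closedBall b.1 (5 * r b) ∧
      ∑' b : u, ENNReal.ofReal (r b ^ p) ≤ ENNReal.ofReal η⁻¹ := by
  have hle (y : X) : r y ^ p ≤ η⁻¹ * μ.real (Metric.closedBall y (r y)) := by
    rw [← div_eq_inv_mul, le_div_iff₀' hη]
    exact hr y
  have hR (y : X) : r y ≤ η⁻¹ ^ p⁻¹ := by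
    rw [Real.le_rpow_inv_iff_of_pos (hr0 y).le (by positivity) hp]
    exact (hle y).trans (mul_le_of_le_one_right (by positivity) measureReal_le_one)
  obtain ⟨u, -, hdisj, hcov⟩ := Vitali.exists_disjoint_subfamily_covering_enlargement_closedBall
    univ id r _ (fun a _ => hR a) 5 (by norm_num)
  have hdisj' : Pairwise (Disjoint on fun b : u => Metric.closedBall b.1 (r b)) :=
    fun b c hbc => hdisj b.2 c.2 (Subtype.coe_injective.ne hbc)
  refine ⟨u, ?_, fun y _ => ?_, ?_⟩
  · have h := Measure.countable_meas_pos_of_disjoint_iUnion (μ := μ)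
      (As := fun b : u => Metric.closedBall b.1 (r b))
      (fun b => Metric.isClosed_closedBall.measurableSet) hdisj'
    have huniv : {b : u | 0 < μ (Metric.closedBall b.1 (r b))} = univ := by
      refine eq_univ_of_forall fun b => ?_
      have : 0 < μ.real (Metric.closedBall b.1 (r b)) :=
        (mul_pos hη (Real.rpow_pos_of_pos (hr0 b) p)).trans_le (hr b)
      exact (ENNReal.toReal_pos_iff.1 this).1
    rw [huniv] at h
    exact countable_coe_iff.1 (countable_univ_iff.1 h)
  · obtain ⟨b, hb, h⟩ := hcov y (mem_univ _)
    exact mem_iUnion.2 ⟨⟨b, hb⟩, h (Metric.mem_closedBall_self (hr0 y).le)⟩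
  · calc ∑' b : u, ENNReal.ofReal (r b ^ p)
        ≤ ∑' b : u, ENNReal.ofReal η⁻¹ * μ (Metric.closedBall b.1 (r b)) := by
          refine ENNReal.tsum_le_tsum fun b => (ENNReal.ofReal_le_ofReal (hle b)).trans ?_
          rw [ENNReal.ofReal_mul (by positivity), ofReal_measureReal]
      _ ≤ ENNReal.ofReal η⁻¹ * 1 := by
          rw [ENNReal.tsum_mul_left]
          gcongr
          exact (tsum_measure_le_measure_univ
            (fun b => Metric.isClosed_closedBall.nullMeasurableSet)
            fun b c hbc => (hdisj' hbc).aedisjoint).trans_eq measure_univ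
      _ = _ := mul_one _

theorem hausdorffMeasure_univ_eq_zero {p : ℝ} (hp : 0 < p)
    (h : ∀ η > 0, ∃ μ : Measure X, IsProbabilityMeasure μ ∧
      ∀ y, ∃ r > 0, η * r ^ p ≤ μ.real (Metric.closedBall y r)) :
    μH[p] (univ : Set X) = 0 := by
  have hcov (n : ℕ) : ∃ (u : Set X) (r : X → ℝ), u.Countable ∧
      (∀ y, 0 < r y) ∧ univ ⊆ ⋃ b : u, Metric.closedBall b.1 (5 * r b) ∧
      ∑' b : u, ENNReal.ofReal (r b ^ p) ≤ ENNReal.ofReal ((n : ℝ) + 1)⁻¹ := by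
    obtain ⟨μ, hμ, hr⟩ := h (n + 1) (by positivity)
    choose r hr0 hr using hr
    obtain ⟨u, h1, h2, h3⟩ :=
      exists_countable_cover_of_le_measure μ (by positivity) hp hr0 hr
    exact ⟨u, r, h1, hr0, h2, h3⟩
  choose u r hu hr0 hcov hsum using hcov
  have hinv : Tendsto (fun n : ℕ => ((n : ℝ) + 1)⁻¹) atTop (𝓝 0) := by
    simpa using tendsto_one_div_add_atTop_nhds_zero_nat (𝕜 := ℝ)
  have hdiam (n : ℕ) (b : u n) :
      Metric.ediam (Metric.closedBall b.1 (5 * r n b)) ≤ ENNReal.ofReal (10 * r n b) :=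
    Metric.ediam_le fun x hx y hy => by
      rw [edist_dist]
      refine ENNReal.ofReal_le_ofReal ?_
      linarith [dist_triangle_right x y b.1, Metric.mem_closedBall.1 hx, Metric.mem_closedBall.1 hy]
  have hle (n : ℕ) (b : u n) : r n b ^ p ≤ ((n : ℝ) + 1)⁻¹ := by
    rw [← ENNReal.ofReal_le_ofReal_iff (by positivity)]
    exact (ENNReal.le_tsum (f := fun b : u n => ENNReal.ofReal (r n b ^ p)) b).trans (hsum n)
  have (n : ℕ) : Countable (u n) := (hu n).to_subtype
  have hbound := Measure.hausdorffMeasure_le_liminf_tsum p (univ : Set X) (l := atTop)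
    (fun n : ℕ => ENNReal.ofReal (10 * ((n : ℝ) + 1)⁻¹ ^ p⁻¹)) (by
      rw [← ENNReal.ofReal_zero]
      refine ENNReal.tendsto_ofReal ?_
      have := (hinv.rpow_const (p := p⁻¹) (.inr (by positivity))).const_mul 10
      simpa only [Real.zero_rpow (inv_ne_zero hp.ne'), mul_zero] using this)
    (fun n (b : u n) => Metric.closedBall b.1 (5 * r n b))
    (.of_forall fun n b => (hdiam n b).trans (ENNReal.ofReal_le_ofReal (by
      gcongr
      rw [Real.le_rpow_inv_iff_of_pos (hr0 n b).le (by positivity) hp]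
      exact hle n b)))
    (.of_forall fun n => hcov n)
  have hlim : Tendsto (fun n => ∑' b : u n, Metric.ediam (Metric.closedBall b.1 (5 * r n b)) ^ p)
      atTop (𝓝 0) := by
    refine tendsto_of_tendsto_of_tendsto_of_le_of_le (g := fun _ => 0)
      (h := fun n : ℕ => ENNReal.ofReal (10 ^ p * ((n : ℝ) + 1)⁻¹)) tendsto_const_nhds ?_
      (fun n => zero_le) fun n => ?_
    · rw [← ENNReal.ofReal_zero]
      refine ENNReal.tendsto_ofReal ?_
      simpa using hinv.const_mul (10 ^ p)
    · calc _ ≤ ∑' b : u n, ENNReal.ofReal (10 ^ p) * ENNReal.ofReal (r n b ^ p) := by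
            refine ENNReal.tsum_le_tsum fun b =>
              (ENNReal.rpow_le_rpow (hdiam n b) hp.le).trans_eq ?_
            rw [ENNReal.ofReal_rpow_of_pos (by linarith [hr0 n b]), ← ENNReal.ofReal_mul
              (by positivity), Real.mul_rpow (by norm_num) (hr0 n b).le]
        _ ≤ ENNReal.ofReal (10 ^ p * ((n : ℝ) + 1)⁻¹) := by
            rw [ENNReal.tsum_mul_left, ENNReal.ofReal_mul (by positivity)]
            gcongr
            exact hsum n
  rw [hlim.liminf_eq] at hbound
  exact le_antisymm hbound zero_le

end Frostman

section Frostman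

open Filter Topology
open scoped NNReal

theorem truncRiesz_half_pow_le {s : ℝ} (hs : 0 ≤ s) (N : ℕ) (r : ℝ) :
    truncRiesz s (2⁻¹ ^ N) r
      ≤ 1 + ∑ j ∈ Finset.range N, (2 ^ s) ^ (j + 1) * (Iic (2⁻¹ ^ j)).indicator 1 r := by
  induction N with
  | zero =>
    simpa [truncRiesz] using
      Real.rpow_le_one_of_one_le_of_nonpos (le_max_right r 1) (neg_nonpos.2 hs)
  | succ N ih =>
    rw [Finset.sum_range_succ, ← add_assoc]
    by_cases hr : r ≤ 2⁻¹ ^ N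
    · rw [indicator_of_mem (mem_Iic.2 hr), Pi.one_apply, mul_one]
      have h0 : 0 ≤ truncRiesz s (2⁻¹ ^ N) r := truncRiesz_nonneg (by positivity) r
      have h : truncRiesz s (2⁻¹ ^ (N + 1)) r ≤ (2 ^ s) ^ (N + 1) := by
        refine (Real.rpow_le_rpow_of_nonpos (by positivity) (le_max_right _ _)
          (neg_nonpos.2 hs)).trans_eq ?_
        rw [← Real.rpow_natCast, ← Real.rpow_natCast, Real.inv_rpow two_pos.le,
          Real.rpow_neg (by positivity), Real.inv_rpow (by positivity), inv_inv,
          ← Real.rpow_mul two_pos.le, ← Real.rpow_mul two_pos.le, mul_comm]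
      linarith
    · rw [indicator_of_notMem (by simpa using hr), mul_zero, add_zero]
      refine le_trans (le_of_eq ?_) ih
      push Not at hr
      have h : (2⁻¹ : ℝ) ^ (N + 1) ≤ 2⁻¹ ^ N :=
        pow_le_pow_of_le_one (by norm_num) (by norm_num) N.le_succ
      rw [truncRiesz, truncRiesz, max_eq_left (h.trans hr.le), max_eq_left hr.le]

variable {X : Type*} [MetricSpace X] [MeasurableSpace X] [BorelSpace X]

/-- If a truncated Riesz potential is large at `y`, then some ball around `y` has large measure. -/
theorem exists_le_measure_closedBall (μ : Measure X) [IsProbabilityMeasure μ] {s p η : ℝ}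
    (hs : 0 ≤ s) (hsp : s < p) (hη : 0 < η) {N : ℕ} {y : X}
    (hint : Integrable (fun x => truncRiesz s (2⁻¹ ^ N) (dist y x)) μ)
    (h : 1 + η * (2 ^ s / (1 - 2 ^ (s - p))) < ∫ x, truncRiesz s (2⁻¹ ^ N) (dist y x) ∂μ) :
    ∃ r > 0, η * r ^ p ≤ μ.real (Metric.closedBall y r) := by
  by_contra! hcon
  have hlt : (2 : ℝ) ^ (s - p) < 1 :=
    Real.rpow_lt_one_of_one_lt_of_neg one_lt_two (by linarith)
  have hterm (j : ℕ) : Integrable (fun x => ((2 : ℝ) ^ s) ^ (j + 1) *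
      (Metric.closedBall y (2⁻¹ ^ j)).indicator (1 : X → ℝ) x) μ :=
    ((integrable_indicator_iff Metric.isClosed_closedBall.measurableSet).2
      (integrable_const (1 : ℝ)).integrableOn).const_mul _
  refine h.not_ge ?_
  calc ∫ x, truncRiesz s (2⁻¹ ^ N) (dist y x) ∂μ
      ≤ ∫ x, (1 + ∑ j ∈ Finset.range N, ((2 : ℝ) ^ s) ^ (j + 1) *
          (Metric.closedBall y (2⁻¹ ^ j)).indicator (1 : X → ℝ) x) ∂μ := by
        refine integral_mono hint ((integrable_const _).add
          (integrable_finsetSum _ fun j _ => hterm j)) fun x => ?_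
        refine (truncRiesz_half_pow_le hs N (dist y x)).trans_eq ?_
        simp only [indicator, Metric.mem_closedBall', mem_Iic, Pi.one_apply]
    _ = 1 + ∑ j ∈ Finset.range N,
          (2 ^ s) ^ (j + 1) * μ.real (Metric.closedBall y (2⁻¹ ^ j)) := by
        rw [integral_add (integrable_const _) (integrable_finsetSum _ fun j _ => hterm j),
          integral_finsetSum _ fun j _ => hterm j]
        simp_rw [integral_const_mul,
          integral_indicator_one Metric.isClosed_closedBall.measurableSet]
        simp
    _ ≤ 1 + ∑ j ∈ Finset.range N, η * (2 ^ s * (2 ^ (s - p)) ^ j) := by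
        refine add_le_add_right (Finset.sum_le_sum fun j _ => ?_) 1
        calc _ ≤ ((2 : ℝ) ^ s) ^ (j + 1) * (η * (2⁻¹ ^ j) ^ p) := by
              gcongr
              exact (hcon _ (by positivity)).le
          _ = η * (2 ^ s * (2 ^ (s - p)) ^ j) := by
              rw [← Real.rpow_natCast (2⁻¹ : ℝ), ← Real.rpow_mul (by norm_num), mul_comm (j : ℝ),
                Real.rpow_mul (by norm_num), Real.rpow_natCast, Real.inv_rpow two_pos.le,
                Real.rpow_sub two_pos, pow_succ, div_pow, inv_pow]
              ring
    _ ≤ 1 + η * (2 ^ s / (1 - 2 ^ (s - p))) := by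
        rw [← Finset.mul_sum, ← Finset.mul_sum, div_eq_mul_inv]
        gcongr
        have h1 := (summable_geometric_of_lt_one (by positivity) hlt).sum_le_tsum
          (Finset.range N) fun j _ => by positivity
        rwa [tsum_geometric_of_lt_one (by positivity) hlt] at h1

/-- A form of Frostman's lemma, tested against Gaussians. -/
theorem exists_frostman [CompactSpace X] [Nonempty X] {s : ℝ} {p : ℝ≥0} (hs : 0 ≤ s) (hsp : s < p)
    (hp : (p : ℝ≥0∞) < dimH (univ : Set X)) :
    ∃ μ : Measure X, IsProbabilityMeasure μ ∧ ∃ C, 0 ≤ C ∧ ∀ x, ∀ l > 0,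
      ∫ y, Real.exp (-(l ^ 2 * dist x y ^ 2)) ∂μ ≤ C * l ^ (-s) := by
  have heps (N : ℕ) : (0 : ℝ) < 2⁻¹ ^ N := by positivity
  have heq (N : ℕ) := exists_potential_le (X := X) (κ := truncRiesz s (2⁻¹ ^ N))
    (continuous_truncRiesz (heps N)).continuousOn
    (fun r r' _ h => truncRiesz_anti hs (heps N) h) (by positivity)
    (fun r _ => truncRiesz_le_two_mul hs (heps N))
  choose μ hμ I hlow hup using heq
  have hcont (N : ℕ) (y : X) : Continuous fun x => truncRiesz s (2⁻¹ ^ N) (dist y x) :=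
    (continuous_truncRiesz (heps N)).comp (by fun_prop)
  obtain ⟨M, hM⟩ : ∃ M, ∀ N, I N ≤ M := by
    by_contra! hcon
    have h0 : μH[(p : ℝ)] (univ : Set X) = 0 := by
      refine hausdorffMeasure_univ_eq_zero (hs.trans_lt hsp) fun η hη => ?_
      obtain ⟨N, hN⟩ := hcon (1 + η * (2 ^ s / (1 - 2 ^ (s - p))))
      exact ⟨μ N, hμ N, fun y => exists_le_measure_closedBall (μ N) hs hsp hη
        (integrable_of_continuous _ (hcont N y)) (hN.trans_le (hlow N y))⟩
    rw [hausdorffMeasure_of_lt_dimH hp] at h0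
    exact ENNReal.top_ne_zero h0
  obtain ⟨C, hC, hexp⟩ := exists_exp_neg_le_truncRiesz hs
  let P (N : ℕ) : ProbabilityMeasure X := ⟨μ N, hμ N⟩
  obtain ⟨ν, -, hν⟩ := isCompact_univ.ultrafilter_le_nhds ((hyperfilter ℕ).map P) (by simp)
  refine ⟨ν, inferInstance, C * (2 ^ s * |M|), by positivity, fun x l hl => ?_⟩
  have hg : Continuous fun y => Real.exp (-(l ^ 2 * dist x y ^ 2)) := by fun_prop
  have hlim : Tendsto (fun N => ∫ y, Real.exp (-(l ^ 2 * dist x y ^ 2)) ∂(μ N)) (hyperfilter ℕ)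
      (𝓝 (∫ y, Real.exp (-(l ^ 2 * dist x y ^ 2)) ∂(ν : Measure X))) :=
    (ProbabilityMeasure.continuous_integral_boundedContinuousFunction
      (BoundedContinuousFunction.mkOfCompact ⟨_, hg⟩)).continuousAt.tendsto.comp hν
  refine le_of_tendsto hlim ?_
  have hev : ∀ᶠ N in atTop, l * 2⁻¹ ^ N < (1 : ℝ) :=
    ((tendsto_pow_atTop_nhds_zero_of_lt_one (by norm_num) (by norm_num)).const_mul
      l).eventually_lt_const (by simp)
  filter_upwards [Nat.hyperfilter_le_atTop hev] with N hN
  have := hμ N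
  calc ∫ y, Real.exp (-(l ^ 2 * dist x y ^ 2)) ∂(μ N)
      ≤ ∫ y, C * l ^ (-s) * truncRiesz s (2⁻¹ ^ N) (dist x y) ∂(μ N) :=
        integral_mono (integrable_of_continuous _ hg)
          (integrable_of_continuous _ ((hcont N x).const_mul _))
          fun y => hexp l hl _ (heps N) hN.le _ dist_nonneg
    _ ≤ C * l ^ (-s) * (2 ^ s * |M|) := by
        rw [integral_const_mul]
        gcongr
        exact (hup N x).trans (by gcongr; exact (hM N).trans (le_abs_self M))
    _ = C * (2 ^ s * |M|) * l ^ (-s) := by ring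

end Frostman

section Compact

open Filter Topology
open scoped NNReal

theorem integrableOn_Ioi_zero_of_eq_rpow {f : ℝ → ℝ} {K γ : ℝ} (hf : IntegrableOn f (Ioc 0 1))
    (hγ : γ < -1) (h : ∀ τ, 1 < τ → f τ = K * τ ^ γ) : IntegrableOn f (Ioi 0) := by
  rw [← Ioc_union_Ioi_eq_Ioi zero_le_one]
  refine hf.union (IntegrableOn.congr_fun ((integrableOn_Ioi_rpow_of_lt hγ one_pos).const_mul K)
    (fun τ hτ => (h τ hτ).symm) measurableSet_Ioi)

theorem exists_interval_of_lt_dimH {d : ℕ} {E : Set (EuclideanSpace ℝ (Fin d))} (hE : IsCompact E)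
    (hdim : ((d : ℝ≥0∞) + 3) / 2 < dimH E) :
    ∃ v₁ v₂ : ℝ, 0 ≤ v₁ ∧ v₁ < v₂ ∧ ∀ v ∈ Ioo v₁ v₂, ∀ m : ℕ, ∃ x : Fin (m + 1 + m + 1) → E,
      (∀ i, ‖(x i : EuclideanSpace ℝ (Fin d)) - x (i + 1)‖ ^ 2 = v) ∧ Function.Injective x := by
  obtain ⟨p, hp1, hp2⟩ := ENNReal.lt_iff_exists_nnreal_btwn.1 hdim
  have hp1' : ((d : ℝ) + 3) / 2 < p := by
    have h : (((d + 3) / 2 : ℝ≥0) : ℝ≥0∞) < p := by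
      rw [ENNReal.coe_div two_ne_zero]
      push_cast
      exact hp1
    exact_mod_cast ENNReal.coe_lt_coe.1 h
  obtain ⟨s, hs, hsp⟩ := exists_between hp1'
  have hs0 : 0 < s := lt_trans (by positivity) hs
  have : CompactSpace E := isCompact_iff_compactSpace.1 hE
  have hne : E.Nonempty := by
    by_contra! h
    simp [h] at hdim
  have : Nonempty E := hne.to_subtype
  have hp2' : (p : ℝ≥0∞) < dimH (univ : Set E) := by
    rwa [← isometry_subtype_coe.dimH_image, image_univ, Subtype.range_coe]
  obtain ⟨μ, hμ, C, hC, hfrost⟩ := exists_frostman hs0.le hsp hp2'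
  let e : E → EuclideanSpace ℝ (Fin d) := Subtype.val
  have he : Continuous e := continuous_subtype_val
  have hfrost' : ∀ x, ∀ l > 0, ∫ y, Real.exp (-(l ^ 2 * ‖e x - e y‖ ^ 2)) ∂μ ≤ C * l ^ (-s) := by
    simpa only [Subtype.dist_eq, dist_eq_norm] using hfrost
  obtain ⟨K, hK, hop⟩ := exists_opBound_cos μ he hC hfrost'
  rw [finrank_euclideanSpace_fin] at hop
  obtain ⟨θ, hθ, hθ'⟩ : ∃ θ, 1 / 2 < θ ∧ θ < min 1 (s - d / 2 - 1) :=
    exists_between (lt_min (by norm_num) (by linarith))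
  have hq : Continuous fun p : E × E => ‖e p.1 - e p.2‖ ^ 2 := by fun_prop
  refine exists_cycles_of_opBound μ (q0 := fun x y => ‖e x - e y‖ ^ 2)
    (b := fun τ => if τ ≤ 1 then 1 else K * τ ^ ((d : ℝ) / 2 - s)) hq
    (fun x y => by rw [norm_sub_rev]) (fun x y => by positivity) (fun x => by simp) ?_ ?_ hθ
    (hθ'.le.trans (min_le_left _ _)) ?_ ?_ ?_
  · intro τ hτ
    split_ifs <;> positivity
  · refine integrableOn_Ioi_zero_of_eq_rpow (K := K) (γ := (d : ℝ) / 2 - s) ?_ (by linarith)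
      fun τ hτ => if_neg hτ.not_ge
    exact IntegrableOn.congr_fun (f := fun _ => 1) (integrableOn_const (by simp))
      (fun τ hτ => (if_pos hτ.2).symm) measurableSet_Ioc
  · refine integrableOn_Ioi_zero_of_eq_rpow (K := K) (γ := θ + ((d : ℝ) / 2 - s)) ?_
      (by linarith [hθ'.trans_le (min_le_right _ _)]) fun τ hτ => ?_
    · refine IntegrableOn.congr_fun (f := fun τ => τ ^ θ)
        (Continuous.integrableOn_Ioc (Real.continuous_rpow_const (by linarith)))
        (fun τ hτ => ?_) measurableSet_Ioc
      simp [hτ.2]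
    · rw [if_neg hτ.not_ge, Real.rpow_add (by linarith)]
      ring
  · intro v τ hτ
    split_ifs with h
    · exact opBound_cos μ _
    · exact hop v τ (not_le.1 h)
  · intro δ hδ
    have hlim : Tendsto (fun l : ℝ => C * l ^ (-s)) atTop (𝓝 0) := by
      simpa using (tendsto_rpow_neg_atTop hs0).const_mul C
    obtain ⟨l, hlδ, hl⟩ := ((hlim.eventually_lt_const hδ).and (eventually_gt_atTop 0)).exists
    have hφ : Continuous fun p : E × E => Real.exp (-(l ^ 2 * ‖e p.1 - e p.2‖ ^ 2)) := by fun_prop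
    refine ⟨fun x y => Real.exp (-(l ^ 2 * ‖e x - e y‖ ^ 2)), hφ, fun x y => (Real.exp_pos _).le,
      fun x y => Real.exp_le_one_iff.2 (neg_nonpos.2 (by positivity)), fun x => by simp, ?_⟩
    calc ∫ x, ∫ y, Real.exp (-(l ^ 2 * ‖e x - e y‖ ^ 2)) ∂μ ∂μ ≤ ∫ _, C * l ^ (-s) ∂μ :=
          integral_mono (integrable_of_continuous μ (continuous_integral μ
            (F := fun x y => Real.exp (-(l ^ 2 * ‖e x - e y‖ ^ 2))) hφ)) (integrable_const _)
            fun x => hfrost' x l hl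
      _ ≤ δ := by simpa using hlδ.le

end Compact

end Necklace

/-- Let `d ≥ 4` and let `k` be a positive even integer. If `E ⊆ ℝ^d` is
compact with Hausdorff dimension `> (d+3)/2`, then there is a non-empty open interval
`I ⊆ (0,∞)` such that for every `t ∈ I` the set `E` contains a non-degenerate `k`-necklace
with constant gap `t`, i.e. points `x 0, …, x (k-1) ∈ E`, pairwise distinct, with
`dist (x j) (x (j+1)) = t` cyclically. -/
theorem necklaces_in_sets_of_large_dimension
    (d k : ℕ) (hd : 4 ≤ d) (hk : 0 < k) (hkeven : Even k)
    (E : Set (EuclideanSpace ℝ (Fin d))) (hE : IsCompact E)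
    (hdim : ((d : ℝ≥0∞) + 3) / 2 < dimH E) :
    ∃ a b : ℝ, 0 ≤ a ∧ a < b ∧ ∀ t ∈ Set.Ioo a b,
      ∃ x : Fin k → EuclideanSpace ℝ (Fin d),
        (∀ j, x j ∈ E) ∧ Function.Injective x ∧
        ∀ j : Fin k, dist (x j) (x (finRotate k j)) = t := by
  obtain ⟨v₁, v₂, h0, hlt, h⟩ := Necklace.exists_interval_of_lt_dimH hE hdim
  refine ⟨√v₁, √v₂, Real.sqrt_nonneg _, Real.sqrt_lt_sqrt h0 hlt, fun t ht => ?_⟩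
  have ht0 : 0 < t := (Real.sqrt_nonneg _).trans_lt ht.1
  obtain ⟨r, hr⟩ := hkeven
  obtain ⟨m, rfl⟩ : ∃ m, k = m + 1 + m + 1 := ⟨r - 1, by omega⟩
  obtain ⟨x, hx, hinj⟩ := h (t ^ 2)
    ⟨(Real.sqrt_lt' ht0).1 ht.1, (Real.lt_sqrt ht0.le).1 ht.2⟩ m
  refine ⟨fun i => x i, fun i => (x i).2, Subtype.val_injective.comp hinj, fun i => ?_⟩
  rw [finRotate_apply, dist_eq_norm]
  exact (pow_left_inj₀ (norm_nonneg _) ht0.le two_ne_zero).1 (hx i)
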